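/- Assume all gaps are open, i.e., the band set B has exactly p connected components (closed arcs), called bands. For a band B' and an integer n ≥ 1, let N^{(n,B')} be the number of zeros z₀ of φ_n (counted with multiplicity) satisfying z₀ ≠ 0, z₀/|z₀| ∈ B', and 1 − |z₀| ≤ n^{−1/2}. Then: (a) the supremum over all n ≥ 1 and all bands B' of |N^{(n,B')} − n/p| is finite; (b) there exist C > 0 and N₀ such that for all n ≥ N₀, every zero z₀ of φ_n with z₀ ≠ 0, z₀/|z₀| lying in some band, and 1 − |z₀| ≤ n^{−1/2} in fact satisfies 1 − |z₀| ≤ C·(log n)/n. (Theorem 3.5.) -/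

import Mathlib

open Polynomial Matrix

/-- `ρ_n = (1 - |α_n|²)^{1/2}`. -/
noncomputable def szRho (α : ℕ → ℂ) (n : ℕ) : ℝ := Real.sqrt (1 - ‖α n‖ ^ 2)

/-- The one-step Szegő transfer matrix `A_k(z)`. -/
noncomputable def SzegoA (α : ℕ → ℂ) (k : ℕ) (z : ℂ) : Matrix (Fin 2) (Fin 2) ℂ :=
  ((szRho α k : ℂ))⁻¹ • !![z, -(starRingEnd ℂ (α k)); -z * α k, 1]

/-- The transfer matrix `T_n(z) = A_{n-1}(z) ⋯ A_0(z)`. -/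
noncomputable def SzegoT (α : ℕ → ℂ) : ℕ → ℂ → Matrix (Fin 2) (Fin 2) ℂ
  | 0, _ => 1
  | n + 1, z => SzegoA α n z * SzegoT α n z

/-- The discriminant `Δ(z) = z^{-p/2} tr T_p(z)` (for `p` even, `z ≠ 0`). -/
noncomputable def SzegoDisc (α : ℕ → ℂ) (p : ℕ) (z : ℂ) : ℂ :=
  (z ^ (p / 2))⁻¹ * (SzegoT α p z).trace

/-- The band set `{z : |z| = 1, Δ(z) ∈ [-2,2]}`. -/
def szBandSet (α : ℕ → ℂ) (p : ℕ) : Set ℂ :=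
  {z : ℂ | ‖z‖ = 1 ∧ ∃ t : ℝ, t ∈ Set.Icc (-2 : ℝ) 2 ∧ SzegoDisc α p z = (t : ℂ)}

/-- A band is a connected component of the band set. -/
def szIsBand (α : ℕ → ℂ) (p : ℕ) (B : Set ℂ) : Prop :=
  ∃ z ∈ szBandSet α p, B = connectedComponentIn (szBandSet α p) z

noncomputable def blaschkePhase (a : ℂ) (x : ℝ) : ℝ :=
  x - 2 * (1 - starRingEnd ℂ a * Complex.exp (x * Complex.I)).arg

noncomputable def circlePoisson (a : ℂ) (x : ℝ) : ℝ :=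
  (1 - ‖a‖ ^ 2) / ‖Complex.exp (x * Complex.I) - a‖ ^ 2

lemma one_sub_re_pos {w : ℂ} (hw : ‖w‖ < 1) : 0 < (1 - w).re := by
  have := Complex.re_le_norm w
  simp only [Complex.sub_re, Complex.one_re]; linarith

lemma norm_conj_mul_exp (a : ℂ) (x : ℝ) :
    ‖starRingEnd ℂ a * Complex.exp (x * Complex.I)‖ = ‖a‖ := by
  rw [norm_mul, Complex.norm_exp_ofReal_mul_I, mul_one, RCLike.norm_conj]

lemma exp_mul_conj_exp (x : ℝ) :
    Complex.exp (x * Complex.I) * starRingEnd ℂ (Complex.exp (x * Complex.I)) = 1 := by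
  rw [Complex.mul_conj, Complex.normSq_eq_norm_sq, Complex.norm_exp_ofReal_mul_I]; simp

lemma norm_exp_sub_eq (a : ℂ) (x : ℝ) :
    ‖Complex.exp (x * Complex.I) - a‖ = ‖1 - starRingEnd ℂ a * Complex.exp (x * Complex.I)‖ := by
  have h : Complex.exp (x * Complex.I) - a = Complex.exp (x * Complex.I) *
      starRingEnd ℂ (1 - starRingEnd ℂ a * Complex.exp (x * Complex.I)) := by
    simp only [map_sub, map_one, map_mul, Complex.conj_conj]
    linear_combination a * exp_mul_conj_exp x
  rw [h, norm_mul, Complex.norm_exp_ofReal_mul_I, one_mul, RCLike.norm_conj]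

lemma hasDerivAt_blaschkePhase {a : ℂ} (ha : ‖a‖ < 1) (x : ℝ) :
    HasDerivAt (blaschkePhase a) (circlePoisson a x) x := by
  set w : ℂ := starRingEnd ℂ a * Complex.exp (x * Complex.I) with hw
  have hwn : ‖w‖ = ‖a‖ := norm_conj_mul_exp a x
  have hre := one_sub_re_pos (w := w) (by rw [hwn]; exact ha)
  have hexp : HasDerivAt (fun y : ℝ => Complex.exp (y * Complex.I))
      (Complex.exp (x * Complex.I) * Complex.I) x := by
    have h1 : HasDerivAt (fun y : ℝ => (y : ℂ) * Complex.I) (1 * Complex.I) x :=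
      (Complex.ofRealCLM.hasDerivAt (x := x)).mul_const Complex.I
    simpa using h1.cexp
  have hg : HasDerivAt (fun y : ℝ => 1 - starRingEnd ℂ a * Complex.exp (y * Complex.I))
      (-(starRingEnd ℂ a * (Complex.exp (x * Complex.I) * Complex.I))) x :=
    (hexp.const_mul (starRingEnd ℂ a)).const_sub 1
  have hlog := hg.clog_real (Or.inl hre)
  have him := (Complex.imCLM.hasFDerivAt.comp_hasDerivAt x hlog)
  have hd := (hasDerivAt_id x).sub (him.const_mul 2)
  have hne : (1 - w) ≠ 0 := fun h => by rw [h] at hre; simp at hre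
  have hval : circlePoisson a x = 1 - 2 * Complex.imCLM
      (-(starRingEnd ℂ a * (Complex.exp (x * Complex.I) * Complex.I)) /
        (1 - starRingEnd ℂ a * Complex.exp (x * Complex.I))) := by
    rw [circlePoisson, norm_exp_sub_eq, ← mul_assoc, ← hw, ← hwn, ← Complex.normSq_eq_norm_sq,
      ← Complex.normSq_eq_norm_sq]
    have hns : Complex.normSq (1 - w) ≠ 0 := by simpa using hne
    rw [Complex.imCLM_apply, Complex.div_im]
    field_simp
    simp only [Complex.normSq_apply, Complex.neg_re, Complex.neg_im, Complex.mul_re,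
      Complex.mul_im, Complex.sub_re, Complex.sub_im, Complex.one_re, Complex.one_im,
      Complex.I_re, Complex.I_im]
    ring
  rw [hval]
  refine hd.congr_of_eventuallyEq (Filter.Eventually.of_forall fun y => ?_)
  simp [blaschkePhase, Complex.log_im]

lemma blaschkePhase_add_two_pi (a : ℂ) (x : ℝ) :
    blaschkePhase a (x + 2 * Real.pi) = blaschkePhase a x + 2 * Real.pi := by
  have : Complex.exp ((x + 2 * Real.pi : ℝ) * Complex.I) = Complex.exp (x * Complex.I) := by
    push_cast
    rw [add_mul, Complex.exp_add, Complex.exp_two_pi_mul_I, mul_one]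
  simp only [blaschkePhase, this]; ring

lemma exp_arg_sq_mul_conj (u : ℂ) :
    Complex.exp ((-(2 * u.arg) : ℝ) * Complex.I) * u = starRingEnd ℂ u := by
  have h := Complex.norm_mul_exp_arg_mul_I u
  have h2 : starRingEnd ℂ u = ‖u‖ * Complex.exp (-(u.arg * Complex.I)) := by
    conv_lhs => rw [← h]
    rw [map_mul, ← Complex.exp_conj]; simp
  have : Complex.exp (-(u.arg * Complex.I)) =
      Complex.exp ((-(2 * u.arg) : ℝ) * Complex.I) * Complex.exp (u.arg * Complex.I) := by
    rw [← Complex.exp_add]; congr 1; push_cast; ring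
  rw [h2, this]
  linear_combination (-Complex.exp ((-(2 * u.arg) : ℝ) * Complex.I)) * h

lemma exp_blaschkePhase (a : ℂ) (x : ℝ) :
    Complex.exp (blaschkePhase a x * Complex.I) * (Complex.exp (x * Complex.I) *
      starRingEnd ℂ (Complex.exp (x * Complex.I) - a)) = Complex.exp (x * Complex.I) - a := by
  set u := 1 - starRingEnd ℂ a * Complex.exp (x * Complex.I) with hu
  have h1 := exp_arg_sq_mul_conj u
  have h2 : Complex.exp (blaschkePhase a x * Complex.I) =
      Complex.exp (x * Complex.I) * Complex.exp ((-(2 * u.arg) : ℝ) * Complex.I) := by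
    rw [← Complex.exp_add]; congr 1; simp only [blaschkePhase]; push_cast; ring
  have h3 : Complex.exp (x * Complex.I) *
      starRingEnd ℂ (Complex.exp (x * Complex.I) - a) = u := by
    rw [map_sub, mul_sub, exp_mul_conj_exp, hu]; ring
  rw [h2, h3, mul_assoc, h1, hu]
  simp only [map_sub, map_one, map_mul, Complex.conj_conj]
  linear_combination (-a) * exp_mul_conj_exp x

lemma norm_exp_sub_pos {a : ℂ} (ha : ‖a‖ < 1) (x : ℝ) : 0 < ‖Complex.exp (x * Complex.I) - a‖ := by
  rw [norm_pos_iff, sub_ne_zero]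
  rintro rfl
  rw [Complex.norm_exp_ofReal_mul_I] at ha
  exact lt_irrefl _ ha

lemma continuous_circlePoisson {a : ℂ} (ha : ‖a‖ < 1) : Continuous (circlePoisson a) := by
  unfold circlePoisson
  refine Continuous.div (by fun_prop) (by fun_prop) fun x => ?_
  exact pow_ne_zero _ (norm_exp_sub_pos ha x).ne'

lemma circlePoisson_pos {a : ℂ} (ha : ‖a‖ < 1) (x : ℝ) : 0 < circlePoisson a x := by
  have := norm_nonneg a
  exact div_pos (by nlinarith) (pow_pos (norm_exp_sub_pos ha x) 2)

lemma integral_circlePoisson {a : ℂ} (ha : ‖a‖ < 1) (s t : ℝ) :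
    ∫ x in s..t, circlePoisson a x = blaschkePhase a t - blaschkePhase a s :=
  intervalIntegral.integral_eq_sub_of_hasDerivAt
    (fun x _ => hasDerivAt_blaschkePhase ha x)
    ((continuous_circlePoisson ha).intervalIntegrable _ _)

lemma strictMono_blaschkePhase {a : ℂ} (ha : ‖a‖ < 1) : StrictMono (blaschkePhase a) :=
  strictMono_of_hasDerivAt_pos (hasDerivAt_blaschkePhase ha) (circlePoisson_pos ha)

lemma continuous_blaschkePhase {a : ℂ} (ha : ‖a‖ < 1) : Continuous (blaschkePhase a) :=
  continuous_iff_continuousAt.2 fun x => (hasDerivAt_blaschkePhase ha x).continuousAt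

lemma circlePoisson_ge {a : ℂ} (ha : ‖a‖ < 1) (x : ℝ) : (1 - ‖a‖) / 4 ≤ circlePoisson a x := by
  have h0 := norm_nonneg a
  have h1 : ‖Complex.exp (x * Complex.I) - a‖ ≤ 2 := by
    refine (norm_sub_le _ _).trans ?_
    rw [Complex.norm_exp_ofReal_mul_I]; linarith
  have h2 := norm_exp_sub_pos ha x
  rw [circlePoisson, div_le_div_iff₀ (by norm_num) (by positivity)]
  have : ‖Complex.exp (x * Complex.I) - a‖ ^ 2 ≤ 4 := by nlinarith
  nlinarith [mul_nonneg (by linarith : 0 ≤ 1 - ‖a‖) h0,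
    mul_le_mul_of_nonneg_left this (by linarith : 0 ≤ 1 - ‖a‖)]

lemma circlePoisson_ge_of_near {a : ℂ} (ha : ‖a‖ < 1) {x y : ℝ}
    (hay : a = ‖a‖ * Complex.exp (y * Complex.I)) (hxy : |x - y| ≤ 1 - ‖a‖) :
    1 / (4 * (1 - ‖a‖)) ≤ circlePoisson a x := by
  have h0 := norm_nonneg a
  have hy : ‖Complex.exp (y * Complex.I) - a‖ = 1 - ‖a‖ := by
    have : Complex.exp (y * Complex.I) - a = ((1 - ‖a‖ : ℝ) : ℂ) * Complex.exp (y * Complex.I) := by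
      push_cast; linear_combination -hay
    rw [this, norm_mul, Complex.norm_exp_ofReal_mul_I, Complex.norm_real, Real.norm_of_nonneg] <;>
      linarith
  have hxy' : ‖Complex.exp (x * Complex.I) - Complex.exp (y * Complex.I)‖ ≤ |x - y| := by
    have h : Complex.exp (x * Complex.I) - Complex.exp (y * Complex.I) =
        Complex.exp (y * Complex.I) * (Complex.exp (Complex.I * ((x - y : ℝ) : ℂ)) - 1) := by
      rw [mul_sub, ← Complex.exp_add, mul_one]; congr 2; push_cast; ring
    rw [h, norm_mul, Complex.norm_exp_ofReal_mul_I, one_mul]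
    exact (Real.norm_exp_I_mul_ofReal_sub_one_le (x := x - y)).trans (by simp)
  have h1 : ‖Complex.exp (x * Complex.I) - a‖ ≤ 2 * (1 - ‖a‖) := by
    calc _ = ‖(Complex.exp (x * Complex.I) - Complex.exp (y * Complex.I)) +
          (Complex.exp (y * Complex.I) - a)‖ := by ring_nf
      _ ≤ _ := norm_add_le _ _
      _ ≤ _ := by rw [hy]; linarith
  have h2 := norm_exp_sub_pos ha x
  rw [circlePoisson, div_le_div_iff₀ (by linarith) (by positivity)]
  have : ‖Complex.exp (x * Complex.I) - a‖ ^ 2 ≤ (2 * (1 - ‖a‖)) ^ 2 := by gcongr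
  nlinarith [mul_nonneg (by linarith : 0 ≤ 1 - ‖a‖) h0]

lemma circlePoisson_le_of_far {a : ℂ} (ha : ‖a‖ < 1) {x y d : ℝ} (hd : 0 < d)
    (hay : a = ‖a‖ * Complex.exp (y * Complex.I))
    (hxy : d ≤ ‖Complex.exp (x * Complex.I) - Complex.exp (y * Complex.I)‖) :
    circlePoisson a x ≤ 8 / d ^ 2 * (1 - ‖a‖) := by
  have h0 := norm_nonneg a
  have hy : ‖Complex.exp (y * Complex.I) - a‖ = 1 - ‖a‖ := by
    have : Complex.exp (y * Complex.I) - a = ((1 - ‖a‖ : ℝ) : ℂ) * Complex.exp (y * Complex.I) := by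
      push_cast; linear_combination -hay
    rw [this, norm_mul, Complex.norm_exp_ofReal_mul_I, Complex.norm_real, Real.norm_of_nonneg] <;>
      linarith
  have h3 : 1 - ‖a‖ ≤ ‖Complex.exp (x * Complex.I) - a‖ := by
    have := norm_sub_norm_le (Complex.exp (x * Complex.I)) a
    rwa [Complex.norm_exp_ofReal_mul_I] at this
  have h1 : ‖Complex.exp (x * Complex.I) - Complex.exp (y * Complex.I)‖ ≤
      ‖Complex.exp (x * Complex.I) - a‖ + ‖Complex.exp (y * Complex.I) - a‖ := by
    rw [norm_sub_rev (Complex.exp (y * Complex.I))]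
    calc _ = ‖(Complex.exp (x * Complex.I) - a) + (a - Complex.exp (y * Complex.I))‖ := by ring_nf
      _ ≤ _ := norm_add_le _ _
  have h2 := norm_exp_sub_pos ha x
  have h4 : d / 2 ≤ ‖Complex.exp (x * Complex.I) - a‖ := by linarith
  have h5 : (d / 2) ^ 2 ≤ ‖Complex.exp (x * Complex.I) - a‖ ^ 2 := by gcongr
  rw [circlePoisson, div_mul_eq_mul_div, div_le_div_iff₀ (by positivity) (by positivity)]
  have h6 : 1 - ‖a‖ ^ 2 ≤ 2 * (1 - ‖a‖) := by nlinarith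
  calc (1 - ‖a‖ ^ 2) * d ^ 2 ≤ 2 * (1 - ‖a‖) * d ^ 2 := by gcongr
    _ = 8 * (1 - ‖a‖) * (d / 2) ^ 2 := by ring
    _ ≤ _ := by gcongr

lemma sum_integral_add_le {ι : Type*} (S : Finset ι) (s t : ι → ℝ) {A B u v : ℝ} {P : ℝ → ℝ}
    (hP : Continuous P) (hP0 : ∀ x, 0 ≤ P x) (hst : ∀ i ∈ S, s i ≤ t i)
    (hA : ∀ i ∈ S, A ≤ s i) (hB : ∀ i ∈ S, t i ≤ B)
    (hdisj : ∀ i ∈ S, ∀ j ∈ S, i ≠ j → Disjoint (Set.Icc (s i) (t i)) (Set.Icc (s j) (t j)))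
    (huv : u ≤ v) (hAu : A ≤ u) (hvB : v ≤ B)
    (huvd : ∀ i ∈ S, Disjoint (Set.Ioo u v) (Set.Icc (s i) (t i))) :
    (∑ i ∈ S, ∫ x in (s i)..(t i), P x) + ∫ x in u..v, P x ≤ ∫ x in A..B, P x := by
  have hint : ∀ X Y : ℝ, MeasureTheory.IntegrableOn P (Set.Ioc X Y) := fun X Y =>
    (hP.integrableOn_Icc (a := X) (b := Y)).mono_set Set.Ioc_subset_Icc_self
  have hint' : ∀ X Y : ℝ, MeasureTheory.IntegrableOn P (Set.Ioo X Y) := fun X Y =>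
    (hint X Y).mono_set Set.Ioo_subset_Ioc_self
  rw [intervalIntegral.integral_of_le huv, intervalIntegral.integral_of_le (by linarith),
    MeasureTheory.integral_Ioc_eq_integral_Ioo (x := u)]
  have h1 : ∑ i ∈ S, ∫ x in (s i)..(t i), P x = ∫ x in ⋃ i ∈ S, Set.Ioc (s i) (t i), P x := by
    rw [MeasureTheory.integral_biUnion_finset S (fun i _ => measurableSet_Ioc)]
    · exact Finset.sum_congr rfl fun i hi => intervalIntegral.integral_of_le (hst i hi)
    · intro i hi j hj hij
      exact (hdisj i hi j hj hij).mono Set.Ioc_subset_Icc_self Set.Ioc_subset_Icc_self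
    · exact fun i _ => hint _ _
  have hm : MeasurableSet (⋃ i ∈ S, Set.Ioc (s i) (t i)) :=
    Finset.measurableSet_biUnion S fun i _ => measurableSet_Ioc
  rw [h1, ← MeasureTheory.setIntegral_union _ measurableSet_Ioo
    ((MeasureTheory.integrableOn_finset_iUnion).2 fun i _ => hint _ _) (hint' _ _)]
  · refine MeasureTheory.setIntegral_mono_set (hint _ _)
      (Filter.Eventually.of_forall fun x => hP0 x) (Filter.Eventually.of_forall ?_)
    intro x hx
    rcases hx with hx | hx
    · simp only [Set.mem_iUnion] at hx
      obtain ⟨i, hi, hx⟩ := hx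
      exact ⟨(hA i hi).trans_lt hx.1, hx.2.trans (hB i hi)⟩
    · exact ⟨hAu.trans_lt hx.1, hx.2.le.trans hvB⟩
  · rw [Set.disjoint_iUnion₂_left]
    exact fun i hi => ((huvd i hi).symm).mono_left Set.Ioc_subset_Icc_self

lemma exists_mem_Ico_eq_norm_mul_exp (a : ℂ) (θ₀ : ℝ) :
    ∃ y ∈ Set.Ico θ₀ (θ₀ + 2 * Real.pi), a = ‖a‖ * Complex.exp (y * Complex.I) := by
  refine ⟨toIcoMod Real.two_pi_pos θ₀ a.arg, toIcoMod_mem_Ico _ _ _, ?_⟩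
  have h : (toIcoMod Real.two_pi_pos θ₀ a.arg : ℝ) =
      a.arg - toIcoDiv Real.two_pi_pos θ₀ a.arg * (2 * Real.pi) := by
    have := toIcoMod_add_toIcoDiv_zsmul Real.two_pi_pos θ₀ a.arg
    rw [zsmul_eq_mul] at this; linarith
  have h2 : Complex.exp ((toIcoMod Real.two_pi_pos θ₀ a.arg : ℝ) * Complex.I) =
      Complex.exp (a.arg * Complex.I) := by
    rw [Complex.exp_eq_exp_iff_exists_int]
    refine ⟨-toIcoDiv Real.two_pi_pos θ₀ a.arg, ?_⟩
    rw [h]; push_cast; ring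
  rw [h2, Complex.norm_mul_exp_arg_mul_I]

lemma exists_separation {ι : Type*} (S : Finset ι) (s t : ι → ℝ) {A B : ℝ}
    (hA : ∀ i ∈ S, A < s i) (hB : ∀ i ∈ S, t i < B) (hAB : A < B)
    (hdisj : ∀ i ∈ S, ∀ j ∈ S, i ≠ j → Disjoint (Set.Icc (s i) (t i)) (Set.Icc (s j) (t j))) :
    ∃ l : ℝ, 0 < l ∧ l ≤ 1 ∧ A + 2 * l ≤ B ∧ (∀ i ∈ S, A + 2 * l ≤ s i) ∧
      (∀ i ∈ S, t i + 2 * l ≤ B) ∧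
      ∀ i ∈ S, ∀ j ∈ S, i ≠ j → ∀ x ∈ Set.Icc (s i) (t i), ∀ y ∈ Set.Icc (s j) (t j),
        2 * l < |x - y| := by
  have key : ∀ c : ℝ, 0 < c → ∀ᶠ l : ℝ in nhdsWithin 0 (Set.Ioi 0), 2 * l < c := fun c hc => by
    filter_upwards [Ioo_mem_nhdsGT (half_pos hc)] with l hl
    linarith [hl.2]
  have h1 : ∀ᶠ l : ℝ in nhdsWithin 0 (Set.Ioi 0), ∀ i ∈ S, A + 2 * l ≤ s i :=
    (Filter.eventually_all_finset S).2 fun i hi => (key _ (sub_pos.2 (hA i hi))).mono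
      fun l hl => by linarith
  have h2 : ∀ᶠ l : ℝ in nhdsWithin 0 (Set.Ioi 0), ∀ i ∈ S, t i + 2 * l ≤ B :=
    (Filter.eventually_all_finset S).2 fun i hi => (key _ (sub_pos.2 (hB i hi))).mono
      fun l hl => by linarith
  have h3 : ∀ᶠ l : ℝ in nhdsWithin 0 (Set.Ioi 0), ∀ i ∈ S, ∀ j ∈ S, i ≠ j →
      ∀ x ∈ Set.Icc (s i) (t i), ∀ y ∈ Set.Icc (s j) (t j), 2 * l < |x - y| := by
    refine (Filter.eventually_all_finset S).2 fun i hi =>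
      (Filter.eventually_all_finset S).2 fun j hj => ?_
    by_cases hij : i = j
    · exact Filter.Eventually.of_forall fun l h => (h hij).elim
    have hd := hdisj i hi j hj hij
    by_cases hx : s i ≤ t i
    swap
    · exact Filter.Eventually.of_forall fun l _ x hx' => (hx (hx'.1.trans hx'.2)).elim
    by_cases hy : s j ≤ t j
    swap
    · exact Filter.Eventually.of_forall fun l _ x _ y hy' => (hy (hy'.1.trans hy'.2)).elim
    rcases lt_or_ge (t i) (s j) with h | h
    · filter_upwards [key _ (sub_pos.2 h)] with l hl _ x hx y hy
      rw [abs_sub_comm]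
      exact lt_of_lt_of_le (by linarith [hx.2, hy.1]) (le_abs_self _)
    rcases lt_or_ge (t j) (s i) with h' | h'
    · filter_upwards [key _ (sub_pos.2 h')] with l hl _ x hx y hy
      exact lt_of_lt_of_le (by linarith [hx.1, hy.2]) (le_abs_self _)
    · have hmem : max (s i) (s j) ∈ Set.Icc (s i) (t i) := ⟨le_max_left _ _, max_le hx h⟩
      exact (Set.disjoint_left.1 hd hmem ⟨le_max_right _ _, max_le h' hy⟩).elim
  have h4 : ∀ᶠ l : ℝ in nhdsWithin 0 (Set.Ioi 0), 0 < l := self_mem_nhdsWithin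
  obtain ⟨l, h1, h2, h3, h4, h5, h6⟩ :=
    (h1.and (h2.and (h3.and (h4.and ((key 1 one_pos).and (key _ (sub_pos.2 hAB))))))).exists
  exact ⟨l, h4, by linarith, by linarith, h1, h2, h3⟩

lemma le_norm_exp_sub_exp {l x y : ℝ} (hl : 0 < l) (h1 : 2 * l ≤ |x - y|)
    (h2 : |x - y| ≤ 2 * Real.pi - 2 * l) :
    2 * Real.sin l ≤ ‖Complex.exp (x * Complex.I) - Complex.exp (y * Complex.I)‖ := by
  have h : Complex.exp (x * Complex.I) - Complex.exp (y * Complex.I) =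
      Complex.exp (y * Complex.I) * (Complex.exp (Complex.I * ((x - y : ℝ) : ℂ)) - 1) := by
    rw [mul_sub, ← Complex.exp_add, mul_one]; congr 2; push_cast; ring
  rw [h, norm_mul, Complex.norm_exp_ofReal_mul_I, one_mul,
    Complex.norm_exp_I_mul_ofReal_sub_one, norm_mul, Real.norm_of_nonneg zero_le_two]
  have h3 : ‖Real.sin ((x - y) / 2)‖ = |Real.sin (|x - y| / 2)| := by
    rw [Real.norm_eq_abs]
    rcases abs_cases (x - y) with h | h
    · rw [h.1]
    · rw [h.1, neg_div, Real.sin_neg, abs_neg]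
  rw [h3]
  refine mul_le_mul_of_nonneg_left (le_trans ?_ (le_abs_self _)) zero_le_two
  rcases le_total (|x - y| / 2) (Real.pi / 2) with h | h
  · exact Real.sin_le_sin_of_le_of_le_pi_div_two (by linarith) h (by linarith)
  · rw [← Real.sin_pi_sub (|x - y| / 2)]
    exact Real.sin_le_sin_of_le_of_le_pi_div_two (by linarith) (by linarith) (by linarith)

lemma mul_sub_le_integral {P : ℝ → ℝ} (hP : Continuous P) {c u v : ℝ} (huv : u ≤ v)
    (h : ∀ x ∈ Set.Icc u v, c ≤ P x) : c * (v - u) ≤ ∫ x in u..v, P x := by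
  have := intervalIntegral.integral_mono_on (μ := MeasureTheory.volume) huv (f := fun _ => c) (g := P)
    (continuous_const.intervalIntegrable _ _) (hP.intervalIntegrable _ _) h
  simpa [mul_comm] using this

lemma integral_le_mul_sub {P : ℝ → ℝ} (hP : Continuous P) {c u v : ℝ} (huv : u ≤ v)
    (h : ∀ x ∈ Set.Icc u v, P x ≤ c) : ∫ x in u..v, P x ≤ c * (v - u) := by
  have := intervalIntegral.integral_mono_on (μ := MeasureTheory.volume) huv (f := P) (g := fun _ => c)
    (hP.intervalIntegrable _ _) (continuous_const.intervalIntegrable _ _) h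
  simpa [mul_comm] using this

open scoped Classical in
lemma exists_pointwise_phase_bound {ι : Type*} (S : Finset ι) (s t : ι → ℝ) {θ₀ : ℝ}
    (hst : ∀ i ∈ S, s i ≤ t i)
    (hA : ∀ i ∈ S, θ₀ < s i) (hB : ∀ i ∈ S, t i < θ₀ + 2 * Real.pi)
    (hdisj : ∀ i ∈ S, ∀ j ∈ S, i ≠ j → Disjoint (Set.Icc (s i) (t i)) (Set.Icc (s j) (t j))) :
    ∃ M : ℝ, 0 < M ∧ ∀ a : ℂ, ‖a‖ < 1 →
      1 - ‖a‖ ≤ M * (2 * Real.pi - ∑ i ∈ S, (blaschkePhase a (t i) - blaschkePhase a (s i))) ∧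
      ∀ i ∈ S, blaschkePhase a (t i) - blaschkePhase a (s i) ≤
        2 * Real.pi * (if a ≠ 0 ∧ ∃ x ∈ Set.Icc (s i) (t i),
          a = ‖a‖ * Complex.exp (x * Complex.I) then 1 else 0) +
        M * (2 * Real.pi - ∑ i ∈ S, (blaschkePhase a (t i) - blaschkePhase a (s i))) := by
  have hpi := Real.pi_pos
  obtain ⟨l, hl0, hl1, hAB, hsl, htl, hsep⟩ := exists_separation S s t hA hB (by linarith) hdisj
  have hlpi : l < Real.pi := by linarith [Real.pi_gt_three]
  set d := 2 * Real.sin l with hd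
  have hd0 : 0 < d := mul_pos two_pos (Real.sin_pos_of_pos_of_lt_pi hl0 hlpi)
  set M := 4 / l + 8 * Real.pi / l + 2 * Real.pi * (8 / d ^ 2) * (4 / l) with hM
  have hM1 : 0 < 4 / l := by positivity
  have hM2 : 0 < 8 * Real.pi / l := by positivity
  have hM3 : 0 < 2 * Real.pi * (8 / d ^ 2) * (4 / l) := by positivity
  refine ⟨M, by positivity, fun a ha => ?_⟩
  set e := 2 * Real.pi - ∑ i ∈ S, (blaschkePhase a (t i) - blaschkePhase a (s i)) with he
  have hP := continuous_circlePoisson ha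
  have hP0 := fun x => (circlePoisson_pos ha x).le
  have ha0 := norm_nonneg a
  have hE : ∀ u v : ℝ, u ≤ v → θ₀ ≤ u → v ≤ θ₀ + 2 * Real.pi →
      (∀ i ∈ S, Disjoint (Set.Ioo u v) (Set.Icc (s i) (t i))) →
      ∫ x in u..v, circlePoisson a x ≤ e := by
    intro u v huv hu hv hdis
    have := sum_integral_add_le S s t hP hP0 hst (fun i hi => (hA i hi).le)
      (fun i hi => (hB i hi).le) hdisj huv hu hv hdis
    simp only [integral_circlePoisson ha, blaschkePhase_add_two_pi] at this ⊢
    linarith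
  have hIle : ∀ i ∈ S, blaschkePhase a (t i) - blaschkePhase a (s i) ≤ 2 * Real.pi := by
    intro i hi
    have := (strictMono_blaschkePhase ha).monotone (hB i hi).le
    have := (strictMono_blaschkePhase ha).monotone (hA i hi).le
    rw [blaschkePhase_add_two_pi] at *
    linarith
  have he1 : 1 - ‖a‖ ≤ 4 / l * e := by
    have h1 := hE θ₀ (θ₀ + l) (by linarith) le_rfl (by linarith) fun i hi => by
      refine Set.disjoint_left.2 fun x hx hx' => ?_
      linarith [hx.2, hx'.1, hsl i hi]
    have h2 := mul_sub_le_integral hP (c := (1 - ‖a‖) / 4) (u := θ₀) (v := θ₀ + l) (by linarith)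
      fun x _ => circlePoisson_ge ha x
    rw [div_mul_eq_mul_div, le_div_iff₀ hl0]
    nlinarith
  have he0 : 0 < e := by
    have : 0 < 4 / l * e := by linarith
    exact (pos_iff_pos_of_mul_pos this).1 hM1
  refine ⟨he1.trans (mul_le_mul_of_nonneg_right (by rw [hM]; linarith) he0.le), fun i hi => ?_⟩
  have hMe : M * e = 4 / l * e + 8 * Real.pi / l * e +
    2 * Real.pi * (8 / d ^ 2) * (4 / l) * e := by rw [hM]; ring
  have hp1 : 0 < 4 / l * e := by positivity
  have hp2 : 0 < 8 * Real.pi / l * e := by positivity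
  have hp3 : 0 < 2 * Real.pi * (8 / d ^ 2) * (4 / l) * e := by positivity
  have hbig : l / 4 ≤ e → 2 * Real.pi ≤ 8 * Real.pi / l * e := fun h => by
    rw [div_mul_eq_mul_div, le_div_iff₀ hl0]
    nlinarith
  by_cases haz : a = 0
  · have : l / 4 ≤ e := by
      rw [haz, norm_zero, div_mul_eq_mul_div, le_div_iff₀ hl0] at he1
      linarith
    rw [if_neg (fun h => h.1 haz)]
    linarith [hIle i hi, hbig this]
  obtain ⟨y, hy, hay⟩ := exists_mem_Ico_eq_norm_mul_exp a θ₀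
  by_cases hyS : ∃ j ∈ S, y ∈ Set.Icc (s j) (t j)
  · obtain ⟨j, hj, hyj⟩ := hyS
    by_cases hij : i = j
    · subst hij
      rw [if_pos ⟨haz, y, hyj, hay⟩]
      linarith [hIle i hi]
    · have h1 := integral_le_mul_sub hP (c := 8 / d ^ 2 * (1 - ‖a‖)) (hst i hi) fun x hx => by
        refine circlePoisson_le_of_far ha hd0 hay (le_norm_exp_sub_exp hl0 ?_ ?_)
        · exact (hsep i hi j hj hij x hx y hyj).le
        · have := hsl i hi; have := htl i hi; have := hsl j hj; have := htl j hj
          rw [abs_le]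
          constructor <;> linarith [hx.1, hx.2, hyj.1, hyj.2]
      rw [integral_circlePoisson ha] at h1
      have h2 : 8 / d ^ 2 * (1 - ‖a‖) * (t i - s i) ≤ 8 / d ^ 2 * (4 / l * e) * (2 * Real.pi) := by
        have : t i - s i ≤ 2 * Real.pi := by linarith [hA i hi, hB i hi]
        have : 0 ≤ t i - s i := by linarith [hst i hi]
        gcongr
      have h3 : 0 ≤ 2 * Real.pi * (if a ≠ 0 ∧ ∃ x ∈ Set.Icc (s i) (t i),
          a = ‖a‖ * Complex.exp (x * Complex.I) then (1 : ℝ) else 0) := by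
        split_ifs <;> positivity
      linarith
  · push Not at hyS
    have hgap : (y + l ≤ θ₀ + 2 * Real.pi ∧ ∀ i ∈ S, Disjoint (Set.Icc y (y + l))
        (Set.Icc (s i) (t i))) ∨ (θ₀ ≤ y - l ∧ ∀ i ∈ S, Disjoint (Set.Icc (y - l) y)
        (Set.Icc (s i) (t i))) := by
      by_contra hcon
      rw [not_or] at hcon
      obtain ⟨hc1, hc2⟩ := hcon
      rcases lt_or_ge (θ₀ + 2 * Real.pi) (y + l) with h | h
      · refine hc2 ⟨by linarith, fun i hi => Set.disjoint_left.2 fun x hx hx' => ?_⟩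
        linarith [hx.1, hx'.2, htl i hi]
      rcases lt_or_ge (y - l) θ₀ with h' | h'
      · refine hc1 ⟨h, fun i hi => Set.disjoint_left.2 fun x hx hx' => ?_⟩
        linarith [hx.2, hx'.1, hsl i hi]
      · simp only [h, h', true_and, not_forall] at hc1 hc2
        obtain ⟨j, hj, h1⟩ := hc1
        obtain ⟨k, hk, h2⟩ := hc2
        rw [Set.not_disjoint_iff] at h1 h2
        obtain ⟨x1, hx1, hx1'⟩ := h1
        obtain ⟨x2, hx2, hx2'⟩ := h2
        by_cases hjk : j = k
        · subst hjk
          exact hyS j hj ⟨hx2'.1.trans hx2.2, hx1.1.trans hx1'.2⟩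
        · have := hsep j hj k hk hjk x1 hx1' x2 hx2'
          have h3 : |x1 - x2| ≤ 2 * l := by
            rw [abs_le]; constructor <;> linarith [hx1.1, hx1.2, hx2.1, hx2.2]
          linarith
    have hδ : 0 < 1 - ‖a‖ := by linarith
    set w := min (1 - ‖a‖) l with hw
    have hw0 : 0 < w := lt_min hδ hl0
    have hwδ : w ≤ 1 - ‖a‖ := min_le_left _ _
    have hwl : w ≤ l := min_le_right _ _
    have hfin : l / 4 ≤ 1 / (4 * (1 - ‖a‖)) * w := by
      rw [div_mul_eq_mul_div, one_mul, div_le_div_iff₀ (by norm_num) (by linarith)]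
      rcases min_cases (1 - ‖a‖) l with h | h
      · rw [hw, h.1]; nlinarith
      · rw [hw, h.1]; nlinarith
    have hel : l / 4 ≤ e := by
      rcases hgap with ⟨h1, h2⟩ | ⟨h1, h2⟩
      · have h3 := hE y (y + w) (by linarith) hy.1 (by linarith) fun i hi =>
          (h2 i hi).mono_left (Set.Ioo_subset_Icc_self.trans (Set.Icc_subset_Icc_right (by linarith)))
        have h4 := mul_sub_le_integral hP (c := 1 / (4 * (1 - ‖a‖))) (u := y) (v := y + w)
          (by linarith) fun x hx => circlePoisson_ge_of_near ha hay (by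
            rw [abs_le]; constructor <;> linarith [hx.1, hx.2])
        rw [add_sub_cancel_left] at h4
        linarith
      · have h3 := hE (y - w) y (by linarith) (by linarith) hy.2.le fun i hi =>
          (h2 i hi).mono_left (Set.Ioo_subset_Icc_self.trans (Set.Icc_subset_Icc_left (by linarith)))
        have h4 := mul_sub_le_integral hP (c := 1 / (4 * (1 - ‖a‖))) (u := y - w) (v := y)
          (by linarith) fun x hx => circlePoisson_ge_of_near ha hay (by
            rw [abs_le]; constructor <;> linarith [hx.1, hx.2])
        rw [sub_sub_cancel] at h4
        linarith
    have h3 : 0 ≤ 2 * Real.pi * (if a ≠ 0 ∧ ∃ x ∈ Set.Icc (s i) (t i),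
        a = ‖a‖ * Complex.exp (x * Complex.I) then (1 : ℝ) else 0) := by
      split_ifs <;> positivity
    linarith [hIle i hi, hbig hel]

/-- Orthonormal polynomials together with their reversals. -/
structure IsSzegoPair (α : ℕ → ℂ) (φ φs : ℕ → Polynomial ℂ) : Prop where
  norm_lt : ∀ n, ‖α n‖ < 1
  zero : φ 0 = 1
  zero_rev : φs 0 = 1
  succ : ∀ n, φ (n + 1) =
    C ((szRho α n : ℂ))⁻¹ * (X * φ n - C (starRingEnd ℂ (α n)) * φs n)
  succ_rev : ∀ n, φs (n + 1) = C ((szRho α n : ℂ))⁻¹ * (φs n - C (α n) * (X * φ n))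
  rev : ∀ n, ∀ z : ℂ, z ≠ 0 →
    (φs n).eval z = z ^ n * starRingEnd ℂ ((φ n).eval (starRingEnd ℂ z)⁻¹)

lemma szRho_pos {α : ℕ → ℂ} {n : ℕ} (h : ‖α n‖ < 1) : 0 < szRho α n := by
  refine Real.sqrt_pos.2 ?_
  have := norm_nonneg (α n)
  nlinarith

lemma szRho_sq {α : ℕ → ℂ} {n : ℕ} (h : ‖α n‖ < 1) : szRho α n ^ 2 = 1 - ‖α n‖ ^ 2 := by
  refine Real.sq_sqrt ?_
  have := norm_nonneg (α n)
  nlinarith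

lemma eq_of_eval_eq_of_ne_zero {P Q : Polynomial ℂ} (h : ∀ z : ℂ, z ≠ 0 → P.eval z = Q.eval z) :
    P = Q := by
  refine Polynomial.eq_of_infinite_eval_eq P Q ?_
  refine Set.Infinite.mono (s := {0}ᶜ) (fun z hz => h z hz) ?_
  exact (Set.finite_singleton (0 : ℂ)).infinite_compl

lemma isSzegoPair_of_rev {α : ℕ → ℂ} {φ φs : ℕ → Polynomial ℂ} (hα : ∀ n, ‖α n‖ < 1)
    (hφ0 : φ 0 = 1)
    (hφrec : ∀ n, φ (n + 1) =
      C ((szRho α n : ℂ))⁻¹ * (X * φ n - C (starRingEnd ℂ (α n)) * φs n))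
    (hφs : ∀ n, ∀ z : ℂ, z ≠ 0 →
      aeval z (φs n) = z ^ n * starRingEnd ℂ (aeval ((starRingEnd ℂ z)⁻¹) (φ n))) :
    IsSzegoPair α φ φs := by
  simp only [Polynomial.coe_aeval_eq_eval] at hφs
  refine ⟨hα, hφ0, ?_, hφrec, fun n => ?_, hφs⟩
  · refine eq_of_eval_eq_of_ne_zero fun z hz => ?_
    rw [hφs 0 z hz, hφ0]; simp
  · refine eq_of_eval_eq_of_ne_zero fun z hz => ?_
    have hz' : starRingEnd ℂ z ≠ 0 := (_root_.map_ne_zero _).2 hz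
    rw [hφs (n + 1) z hz, hφrec]
    simp only [eval_mul, eval_C, eval_sub, eval_X]
    rw [hφs n z hz, hφs n _ (inv_ne_zero hz')]
    simp only [map_mul, map_sub, map_inv₀, map_pow, Complex.conj_conj, inv_inv, Complex.conj_ofReal]
    have h1 : z * z⁻¹ = 1 := mul_inv_cancel₀ hz
    have h2 : z ^ n * z⁻¹ ^ n = 1 := by rw [← mul_pow, h1, one_pow]
    set w := starRingEnd ℂ (eval (starRingEnd ℂ z)⁻¹ (φ n))
    linear_combination ((szRho α n : ℂ))⁻¹ * z ^ n * w * h1 -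
      ((szRho α n : ℂ))⁻¹ * α n * z * eval z (φ n) * h2

lemma szegoA_mulVec (α : ℕ → ℂ) (k : ℕ) (z : ℂ) (v : Fin 2 → ℂ) :
    SzegoA α k z *ᵥ v = ![((szRho α k : ℂ))⁻¹ * (z * v 0 - starRingEnd ℂ (α k) * v 1),
      ((szRho α k : ℂ))⁻¹ * (v 1 - α k * (z * v 0))] := by
  ext i
  fin_cases i
  · simp [SzegoA, Matrix.mulVec, dotProduct, Fin.sum_univ_two]; ring
  · simp [SzegoA, Matrix.mulVec, dotProduct, Fin.sum_univ_two]; ring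

lemma det_szegoA {α : ℕ → ℂ} {k : ℕ} (h : ‖α k‖ < 1) (z : ℂ) : (SzegoA α k z).det = z := by
  have hr : (szRho α k : ℂ) ≠ 0 := by exact_mod_cast (szRho_pos h).ne'
  have h2 : (szRho α k : ℂ) ^ 2 = 1 - starRingEnd ℂ (α k) * α k := by
    rw [← Complex.normSq_eq_conj_mul_self, Complex.normSq_eq_norm_sq, ← Complex.ofReal_pow,
      szRho_sq h]
    push_cast; ring
  rw [SzegoA, Matrix.det_smul, Matrix.det_fin_two_of]
  simp only [Fintype.card_fin]
  field_simp
  rw [h2]; ring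

lemma det_szegoT {α : ℕ → ℂ} (h : ∀ n, ‖α n‖ < 1) (n : ℕ) (z : ℂ) :
    (SzegoT α n z).det = z ^ n := by
  induction n with
  | zero => simp [SzegoT]
  | succ n ih => rw [SzegoT, Matrix.det_mul, ih, det_szegoA (h n)]; ring

lemma szegoT_add {α : ℕ → ℂ} {p : ℕ} (hper : ∀ n, α (n + p) = α n) (n : ℕ) (z : ℂ) :
    SzegoT α (n + p) z = SzegoT α n z * SzegoT α p z := by
  induction n with
  | zero => simp [SzegoT]
  | succ n ih =>
    rw [Nat.add_right_comm, SzegoT, ih, SzegoT, Matrix.mul_assoc]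
    congr 1
    simp [SzegoA, szRho, hper]

lemma sq_eq_trace_smul_sub_det (M : Matrix (Fin 2) (Fin 2) ℂ) :
    M * M = M.trace • M - M.det • (1 : Matrix (Fin 2) (Fin 2) ℂ) := by
  ext i j
  fin_cases i <;> fin_cases j <;>
    simp [Matrix.mul_apply, Fin.sum_univ_two, Matrix.trace_fin_two, Matrix.det_fin_two] <;> ring

lemma normSq_szegoA_diff {α : ℕ → ℂ} {k : ℕ} (h : ‖α k‖ < 1) (z : ℂ) (v : Fin 2 → ℂ) :
    ‖(SzegoA α k z *ᵥ v) 1‖ ^ 2 - ‖(SzegoA α k z *ᵥ v) 0‖ ^ 2 =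
      ‖v 1‖ ^ 2 - ‖z‖ ^ 2 * ‖v 0‖ ^ 2 := by
  have hr := szRho_pos h
  have h2 := szRho_sq h
  rw [szegoA_mulVec]
  simp only [Matrix.cons_val_zero, Matrix.cons_val_one, norm_mul, norm_inv, Complex.norm_real,
    Real.norm_of_nonneg hr.le, mul_pow, inv_pow]
  have h3 : ‖v 1 - α k * (z * v 0)‖ ^ 2 - ‖z * v 0 - starRingEnd ℂ (α k) * v 1‖ ^ 2 =
      (1 - ‖α k‖ ^ 2) * (‖v 1‖ ^ 2 - ‖z * v 0‖ ^ 2) := by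
    simp only [← Complex.normSq_eq_norm_sq, Complex.normSq_apply, Complex.sub_re, Complex.sub_im,
      Complex.mul_re, Complex.mul_im, Complex.conj_re, Complex.conj_im]
    ring
  rw [← mul_sub, h3, ← h2, norm_mul]
  field_simp

lemma normSq_szegoT_diff_ge {α : ℕ → ℂ} (h : ∀ n, ‖α n‖ < 1) {z : ℂ} (hz : ‖z‖ ≤ 1)
    (v : Fin 2 → ℂ) (n : ℕ) :
    ‖z‖ ^ (n + 1) * (‖v 1‖ ^ 2 - ‖v 0‖ ^ 2 + (1 - ‖z‖) * (‖v 1‖ ^ 2 + ‖v 0‖ ^ 2)) ≤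
      ‖(SzegoT α (n + 1) z *ᵥ v) 1‖ ^ 2 - ‖(SzegoT α (n + 1) z *ᵥ v) 0‖ ^ 2 := by
  have hz0 := norm_nonneg z
  induction n with
  | zero =>
    simp only [SzegoT, Matrix.mul_one, zero_add, pow_one]
    rw [normSq_szegoA_diff (h 0)]
    nlinarith [mul_nonneg (mul_nonneg (sub_nonneg.2 hz) (sub_nonneg.2 hz)) (sq_nonneg ‖v 1‖)]
  | succ n ih =>
    rw [SzegoT, ← Matrix.mulVec_mulVec, normSq_szegoA_diff (h (n + 1)), pow_succ]
    set w := SzegoT α (n + 1) z *ᵥ v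
    nlinarith [mul_le_mul_of_nonneg_left ih hz0, mul_nonneg (sub_nonneg.2 hz) (sq_nonneg ‖w 1‖),
      mul_nonneg (mul_nonneg hz0 (sub_nonneg.2 hz)) (sq_nonneg ‖w 0‖)]

lemma normSq_szegoT_diff_le {α : ℕ → ℂ} (h : ∀ n, ‖α n‖ < 1) {z : ℂ} (hz : 1 ≤ ‖z‖)
    (v : Fin 2 → ℂ) (n : ℕ) :
    ‖(SzegoT α (n + 1) z *ᵥ v) 1‖ ^ 2 - ‖(SzegoT α (n + 1) z *ᵥ v) 0‖ ^ 2 ≤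
    ‖z‖ ^ n * (‖z‖ * (‖v 1‖ ^ 2 - ‖v 0‖ ^ 2) - (‖z‖ - 1) * (‖v 1‖ ^ 2 + ‖v 0‖ ^ 2)) := by
  have hz0 := norm_nonneg z
  induction n with
  | zero =>
    simp only [SzegoT, Matrix.mul_one, pow_zero, one_mul]
    rw [normSq_szegoA_diff (h 0)]
    nlinarith [mul_nonneg (mul_nonneg (sub_nonneg.2 hz) (sub_nonneg.2 hz)) (sq_nonneg ‖v 0‖)]
  | succ n ih =>
    rw [SzegoT, ← Matrix.mulVec_mulVec, normSq_szegoA_diff (h (n + 1)), pow_succ ‖z‖ n]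
    set w := SzegoT α (n + 1) z *ᵥ v
    nlinarith [mul_le_mul_of_nonneg_left ih hz0, mul_nonneg (sub_nonneg.2 hz) (sq_nonneg ‖w 1‖),
      mul_nonneg (mul_nonneg hz0 (sub_nonneg.2 hz)) (sq_nonneg ‖w 0‖)]

lemma exists_eigenvector {α : ℕ → ℂ} (h : ∀ n, ‖α n‖ < 1) {p : ℕ} {z μ : ℂ}
    (hμ : μ ^ 2 - (SzegoT α p z).trace * μ + z ^ p = 0) :
    ∃ v : Fin 2 → ℂ, v ≠ 0 ∧ SzegoT α p z *ᵥ v = μ • v := by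
  have hdet : (SzegoT α p z - μ • (1 : Matrix (Fin 2) (Fin 2) ℂ)).det = 0 := by
    have hd := det_szegoT h p z
    rw [Matrix.det_fin_two] at hd ⊢
    rw [Matrix.trace_fin_two] at hμ
    simp
    linear_combination hd + hμ
  obtain ⟨v, hv, hv'⟩ := Matrix.exists_mulVec_eq_zero_iff.2 hdet
  refine ⟨v, hv, ?_⟩
  rw [Matrix.sub_mulVec, Matrix.smul_mulVec, Matrix.one_mulVec, sub_eq_zero] at hv'
  exact hv'

lemma norm_sq_add_pos {v : Fin 2 → ℂ} (hv : v ≠ 0) : 0 < ‖v 1‖ ^ 2 + ‖v 0‖ ^ 2 := by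
  by_contra hcon
  apply hv
  have h0 := sq_nonneg ‖v 0‖
  have h1 := sq_nonneg ‖v 1‖
  have h0' : ‖v 0‖ ^ 2 = 0 := by linarith
  have h1' : ‖v 1‖ ^ 2 = 0 := by linarith
  ext i
  fin_cases i
  · simpa using h0'
  · simpa using h1'

lemma eigenvalue_norm_gap {α : ℕ → ℂ} (h : ∀ n, ‖α n‖ < 1) {p : ℕ} (hp : 0 < p) {z μ : ℂ}
    (hz : ‖z‖ ≤ 1) (hμ : μ ^ 2 - (SzegoT α p z).trace * μ + z ^ p = 0) :
    ‖z‖ ^ p * (1 - ‖z‖) ≤ |‖μ‖ ^ 2 - ‖z‖ ^ p| := by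
  obtain ⟨v, hv, hv'⟩ := exists_eigenvector h hμ
  obtain ⟨n, rfl⟩ := Nat.exists_eq_add_of_lt hp
  rw [zero_add] at *
  have h1 := normSq_szegoT_diff_ge h hz v n
  rw [hv'] at h1
  simp only [Pi.smul_apply, smul_eq_mul, norm_mul, mul_pow] at h1
  have hpos := norm_sq_add_pos hv
  set N := ‖v 1‖ ^ 2 + ‖v 0‖ ^ 2
  set q := ‖v 1‖ ^ 2 - ‖v 0‖ ^ 2 with hq
  have hqN : |q| ≤ N := by
    rw [abs_le]; constructor <;> nlinarith [sq_nonneg ‖v 0‖, sq_nonneg ‖v 1‖]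
  have h2 : ‖z‖ ^ (n + 1) * (1 - ‖z‖) * N ≤ (‖μ‖ ^ 2 - ‖z‖ ^ (n + 1)) * q := by
    rw [hq] at *; nlinarith
  have h3 : (‖μ‖ ^ 2 - ‖z‖ ^ (n + 1)) * q ≤ |‖μ‖ ^ 2 - ‖z‖ ^ (n + 1)| * N := by
    refine (le_abs_self _).trans ?_
    rw [abs_mul]
    exact mul_le_mul_of_nonneg_left hqN (abs_nonneg _)
  exact le_of_mul_le_mul_right (h2.trans h3) hpos

lemma norm_eq_one_of_eigenvalue {α : ℕ → ℂ} (h : ∀ n, ‖α n‖ < 1) {p : ℕ} (hp : 0 < p) {z μ : ℂ}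
    (hz : z ≠ 0) (hμ : μ ^ 2 - (SzegoT α p z).trace * μ + z ^ p = 0)
    (hn : ‖μ‖ ^ 2 = ‖z‖ ^ p) : ‖z‖ = 1 := by
  have hz0 : 0 < ‖z‖ := norm_pos_iff.2 hz
  rcases lt_trichotomy ‖z‖ 1 with hlt | heq | hgt
  · have := eigenvalue_norm_gap h hp hlt.le hμ
    rw [hn, sub_self, abs_zero] at this
    have : 0 < ‖z‖ ^ p * (1 - ‖z‖) := mul_pos (pow_pos hz0 p) (by linarith)
    linarith
  · exact heq
  · obtain ⟨v, hv, hv'⟩ := exists_eigenvector h hμ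
    obtain ⟨n, rfl⟩ := Nat.exists_eq_add_of_lt hp
    rw [zero_add] at *
    have h1 := normSq_szegoT_diff_le h hgt.le v n
    rw [hv'] at h1
    simp only [Pi.smul_apply, smul_eq_mul, norm_mul, mul_pow, hn] at h1
    have hpos := norm_sq_add_pos hv
    have h2 : 0 < ‖z‖ ^ n * ((‖z‖ - 1) * (‖v 1‖ ^ 2 + ‖v 0‖ ^ 2)) :=
      mul_pos (pow_pos hz0 n) (mul_pos (by linarith) hpos)
    rw [pow_succ] at h1
    nlinarith

namespace IsSzegoPair

variable {α : ℕ → ℂ} {φ φs : ℕ → Polynomial ℂ}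

lemma szegoT_mulVec (h : IsSzegoPair α φ φs) (n : ℕ) (z : ℂ) :
    SzegoT α n z *ᵥ ![1, 1] = ![(φ n).eval z, (φs n).eval z] := by
  induction n with
  | zero => simp [SzegoT, h.zero, h.zero_rev]
  | succ n ih =>
    rw [SzegoT, ← Matrix.mulVec_mulVec, ih, szegoA_mulVec, h.succ, h.succ_rev]
    simp

lemma eval_ne_zero_or (h : IsSzegoPair α φ φs) (n : ℕ) {z : ℂ} (hz : z ≠ 0) :
    ¬ ((φ n).eval z = 0 ∧ (φs n).eval z = 0) := by
  rintro ⟨h1, h2⟩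
  have h3 := h.szegoT_mulVec n z
  rw [h1, h2] at h3
  have h4 : ∃ v : Fin 2 → ℂ, v ≠ 0 ∧ SzegoT α n z *ᵥ v = 0 := by
    refine ⟨![1, 1], fun hv => ?_, ?_⟩
    · have := congrFun hv 0
      simp at this
    · rw [h3]; ext i; fin_cases i <;> rfl
  rw [Matrix.exists_mulVec_eq_zero_iff, det_szegoT h.norm_lt] at h4
  exact pow_ne_zero n hz h4

lemma norm_lt_one_of_eval_eq_zero (h : IsSzegoPair α φ φs) {n : ℕ} {z : ℂ}
    (hz : (φ n).eval z = 0) : ‖z‖ < 1 := by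
  by_contra hcon
  push Not at hcon
  have hz0 : z ≠ 0 := by rintro rfl; simp at hcon; linarith
  cases n with
  | zero => rw [h.zero] at hz; simp at hz
  | succ n =>
    have h1 := normSq_szegoT_diff_le h.norm_lt hcon ![1, 1] n
    rw [h.szegoT_mulVec] at h1
    simp only [Matrix.cons_val_zero, Matrix.cons_val_one, hz, norm_zero, norm_one] at h1
    have h2 : 0 ≤ ‖z‖ ^ n * ((‖z‖ - 1) * 2) := by
      have : 0 ≤ ‖z‖ - 1 := by linarith
      positivity
    have h3 : ‖(φs (n + 1)).eval z‖ ^ 2 = 0 := by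
      refine le_antisymm ?_ (sq_nonneg _)
      nlinarith
    exact h.eval_ne_zero_or (n + 1) hz0 ⟨hz, by simpa using h3⟩

lemma natDegree_le (h : IsSzegoPair α φ φs) (n : ℕ) :
    (φ n).natDegree ≤ n ∧ (φs n).natDegree ≤ n := by
  induction n with
  | zero => simp [h.zero, h.zero_rev]
  | succ n ih =>
    have hX : (X * φ n).natDegree ≤ n + 1 :=
      natDegree_mul_le.trans (by rw [natDegree_X]; linarith [ih.1])
    rw [h.succ, h.succ_rev]
    constructor
    · refine (natDegree_C_mul_le _ _).trans ((natDegree_sub_le _ _).trans (max_le hX ?_))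
      exact (natDegree_C_mul_le _ _).trans (ih.2.trans n.le_succ)
    · refine (natDegree_C_mul_le _ _).trans ((natDegree_sub_le _ _).trans (max_le ?_ ?_))
      · exact ih.2.trans n.le_succ
      · exact (natDegree_C_mul_le _ _).trans hX

lemma coeff_ne_zero (h : IsSzegoPair α φ φs) (n : ℕ) : (φ n).coeff n ≠ 0 := by
  induction n with
  | zero => simp [h.zero]
  | succ n ih =>
    have hr : (szRho α n : ℂ) ≠ 0 := by exact_mod_cast (szRho_pos (h.norm_lt n)).ne'
    rw [h.succ, coeff_C_mul, coeff_sub, coeff_X_mul, coeff_C_mul,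
      coeff_eq_zero_of_natDegree_lt (Nat.lt_succ_of_le (h.natDegree_le n).2), mul_zero, sub_zero]
    exact mul_ne_zero (inv_ne_zero hr) ih

lemma ne_zero (h : IsSzegoPair α φ φs) (n : ℕ) : φ n ≠ 0 := fun h0 => by
  have := h.coeff_ne_zero n
  simp [h0] at this

lemma card_roots (h : IsSzegoPair α φ φs) (n : ℕ) : Multiset.card (φ n).roots = n := by
  rw [IsAlgClosed.card_roots_eq_natDegree]
  exact le_antisymm (h.natDegree_le n).1 (le_natDegree_of_ne_zero (h.coeff_ne_zero n))

lemma norm_lt_one_of_mem_roots (h : IsSzegoPair α φ φs) {n : ℕ} {a : ℂ} (ha : a ∈ (φ n).roots) :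
    ‖a‖ < 1 :=
  h.norm_lt_one_of_eval_eq_zero ((mem_roots (h.ne_zero n)).1 ha)

lemma eval_rev_exp (h : IsSzegoPair α φ φs) (n : ℕ) (x : ℝ) :
    (φs n).eval (Complex.exp (x * Complex.I)) = Complex.exp (x * Complex.I) ^ n *
      starRingEnd ℂ ((φ n).eval (Complex.exp (x * Complex.I))) := by
  rw [h.rev n _ (Complex.exp_ne_zero _)]
  congr 3
  exact inv_eq_of_mul_eq_one_left (exp_mul_conj_exp x)

variable {p : ℕ}

lemma szegoT_add_add (hα : ∀ n, ‖α n‖ < 1) (hper : ∀ n, α (n + p) = α n) (n : ℕ) (z : ℂ) :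
    SzegoT α (n + p + p) z = (SzegoT α p z).trace • SzegoT α (n + p) z -
      z ^ p • SzegoT α n z := by
  rw [szegoT_add hper (n + p), szegoT_add hper n, Matrix.mul_assoc, sq_eq_trace_smul_sub_det,
    det_szegoT hα, Matrix.mul_sub, Matrix.mul_smul, Matrix.mul_smul, Matrix.mul_one]

lemma eval_recurrence (h : IsSzegoPair α φ φs) (hper : ∀ n, α (n + p) = α n) (n : ℕ) (z : ℂ) :
    (φ (n + p + p)).eval z = (SzegoT α p z).trace * (φ (n + p)).eval z - z ^ p * (φ n).eval z ∧
    (φs (n + p + p)).eval z = (SzegoT α p z).trace * (φs (n + p)).eval z -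
      z ^ p * (φs n).eval z := by
  have h1 := congrArg (fun M => M *ᵥ ![1, 1]) (szegoT_add_add h.norm_lt hper n z)
  simp only [Matrix.sub_mulVec, Matrix.smul_mulVec, h.szegoT_mulVec] at h1
  exact ⟨by simpa using congrFun h1 0, by simpa using congrFun h1 1⟩

end IsSzegoPair

lemma sub_mul_eq_pow_mul_of_recurrence {y : ℕ → ℂ} {μ ν : ℂ}
    (hy : ∀ m, y (m + 2) = (μ + ν) * y (m + 1) - μ * ν * y m) (m : ℕ) :
    y (m + 1) - ν * y m = μ ^ m * (y 1 - ν * y 0) := by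
  induction m with
  | zero => simp
  | succ m ih => rw [hy, pow_succ]; linear_combination μ * ih

lemma eq_pow_mul_of_recurrence {y : ℕ → ℂ} {μ ν : ℂ}
    (hy : ∀ m, y (m + 2) = (μ + ν) * y (m + 1) - μ * ν * y m) (hne : μ ≠ ν) {m : ℕ}
    (hm : μ ^ m = ν ^ m) : y m = μ ^ m * y 0 := by
  have h1 := sub_mul_eq_pow_mul_of_recurrence hy m
  have h2 := sub_mul_eq_pow_mul_of_recurrence (μ := ν) (ν := μ) (y := y)
    (fun k => by rw [hy]; ring) m
  refine mul_left_cancel₀ (sub_ne_zero.2 hne) ?_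
  rw [← hm] at h2
  linear_combination h1 - h2

lemma szegoT_entry_polynomial (α : ℕ → ℂ) (n : ℕ) (i j : Fin 2) :
    ∃ P : Polynomial ℂ, ∀ z, P.eval z = SzegoT α n z i j := by
  induction n generalizing i j with
  | zero => exact ⟨C ((1 : Matrix (Fin 2) (Fin 2) ℂ) i j), fun z => by simp [SzegoT]⟩
  | succ n ih =>
    obtain ⟨P0, h0⟩ := ih 0 j
    obtain ⟨P1, h1⟩ := ih 1 j
    fin_cases i
    · refine ⟨C ((szRho α n : ℂ))⁻¹ * (X * P0 - C (starRingEnd ℂ (α n)) * P1), fun z => ?_⟩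
      simp [SzegoT, SzegoA, Matrix.mul_apply, Fin.sum_univ_two, h0, h1]; ring
    · refine ⟨C ((szRho α n : ℂ))⁻¹ * (P1 - C (α n) * X * P0), fun z => ?_⟩
      simp [SzegoT, SzegoA, Matrix.mul_apply, Fin.sum_univ_two, h0, h1]; ring

lemma trace_szegoT_polynomial (α : ℕ → ℂ) (n : ℕ) :
    ∃ P : Polynomial ℂ, ∀ z, P.eval z = (SzegoT α n z).trace := by
  obtain ⟨P0, h0⟩ := szegoT_entry_polynomial α n 0 0
  obtain ⟨P1, h1⟩ := szegoT_entry_polynomial α n 1 1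
  exact ⟨P0 + P1, fun z => by rw [eval_add, h0, h1, Matrix.trace_fin_two]⟩

lemma conj_szegoT_of_norm_eq_one (α : ℕ → ℂ) (n : ℕ) {z : ℂ} (hz : ‖z‖ = 1) :
    SzegoT α n z 1 1 = z ^ n * starRingEnd ℂ (SzegoT α n z 0 0) ∧
    SzegoT α n z 1 0 = z ^ n * starRingEnd ℂ (SzegoT α n z 0 1) := by
  have hzz : z * starRingEnd ℂ z = 1 := by
    rw [Complex.mul_conj, Complex.normSq_eq_norm_sq, hz]; simp
  induction n with
  | zero => simp [SzegoT]
  | succ n ih =>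
    obtain ⟨h1, h2⟩ := ih
    have hzn : z ^ n * starRingEnd ℂ z ^ n = 1 := by rw [← mul_pow, hzz, one_pow]
    constructor
    · simp [SzegoT, SzegoA, Matrix.mul_apply, Fin.sum_univ_two, h1, h2, pow_succ]
      linear_combination ((szRho α n : ℂ))⁻¹ * (-(z ^ n) * starRingEnd ℂ (SzegoT α n z 0 0)) * hzz +
        ((szRho α n : ℂ))⁻¹ * z * α n * SzegoT α n z 0 1 * hzn
    · simp [SzegoT, SzegoA, Matrix.mul_apply, Fin.sum_univ_two, h1, h2, pow_succ]
      linear_combination ((szRho α n : ℂ))⁻¹ * (-(z ^ n) * starRingEnd ℂ (SzegoT α n z 0 1)) * hzz +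
        ((szRho α n : ℂ))⁻¹ * z * α n * SzegoT α n z 0 0 * hzn

lemma szegoDisc_real_of_norm_eq_one (α : ℕ → ℂ) {p : ℕ} (hp : Even p) {z : ℂ} (hz : ‖z‖ = 1) :
    SzegoDisc α p z = ((SzegoDisc α p z).re : ℂ) := by
  have hzz : z * starRingEnd ℂ z = 1 := by
    rw [Complex.mul_conj, Complex.normSq_eq_norm_sq, hz]; simp
  obtain ⟨k, rfl⟩ := hp
  have hk : (k + k) / 2 = k := by omega
  have hinv : (z ^ k)⁻¹ = starRingEnd ℂ z ^ k := by
    rw [← inv_pow, inv_eq_of_mul_eq_one_right hzz]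
  have hzk : z ^ k * starRingEnd ℂ z ^ k = 1 := by rw [← mul_pow, hzz, one_pow]
  rw [eq_comm, ← Complex.conj_eq_iff_re, SzegoDisc, hk, hinv, Matrix.trace_fin_two,
    (conj_szegoT_of_norm_eq_one α (k + k) hz).1]
  simp only [map_mul, map_add, map_pow, Complex.conj_conj, pow_add]
  linear_combination (starRingEnd ℂ z ^ k * SzegoT α (k + k) z 0 0 -
    z ^ k * starRingEnd ℂ (SzegoT α (k + k) z 0 0)) * hzk

lemma two_mul_cos_eq_exp_add_exp (θ : ℝ) : ((2 * Real.cos θ : ℝ) : ℂ) =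
    Complex.exp (θ * Complex.I) + Complex.exp (-(θ * Complex.I)) := by
  rw [Complex.ofReal_mul, Complex.ofReal_cos, Complex.cos, neg_mul]
  push_cast; ring

lemma trace_eq_pow_mul_exp_add {α : ℕ → ℂ} {p : ℕ} {z : ℂ} (hz : z ≠ 0) {θ : ℝ}
    (hθ : SzegoDisc α p z = ((2 * Real.cos θ : ℝ) : ℂ)) :
    (SzegoT α p z).trace = z ^ (p / 2) * Complex.exp (θ * Complex.I) +
      z ^ (p / 2) * Complex.exp (-(θ * Complex.I)) := by
  rw [← mul_add, ← two_mul_cos_eq_exp_add_exp, ← hθ, SzegoDisc, ← mul_assoc,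
    mul_inv_cancel₀ (pow_ne_zero _ hz), one_mul]

lemma pow_mul_exp_mul_pow_mul_exp {p : ℕ} (hp : Even p) (z : ℂ) (θ : ℝ) :
    z ^ (p / 2) * Complex.exp (θ * Complex.I) * (z ^ (p / 2) * Complex.exp (-(θ * Complex.I))) =
      z ^ p := by
  obtain ⟨k, rfl⟩ := hp
  have hk : (k + k) / 2 = k := by omega
  rw [hk, mul_mul_mul_comm, ← Complex.exp_add, ← pow_add]; simp

lemma norm_eq_one_of_szegoDisc {α : ℕ → ℂ} (h : ∀ n, ‖α n‖ < 1) {p : ℕ} (hp : 0 < p)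
    (hpe : Even p) {z : ℂ} (hz : z ≠ 0) {c : ℝ} (hc : c ∈ Set.Icc (-2 : ℝ) 2)
    (hD : SzegoDisc α p z = (c : ℂ)) : ‖z‖ = 1 := by
  have hcos : 2 * Real.cos (Real.arccos (c / 2)) = c := by
    rw [Real.cos_arccos (by linarith [hc.1]) (by linarith [hc.2])]; ring
  rw [← hcos] at hD
  set θ := Real.arccos (c / 2)
  refine norm_eq_one_of_eigenvalue h hp hz
    (μ := z ^ (p / 2) * Complex.exp (θ * Complex.I)) ?_ ?_
  · rw [trace_eq_pow_mul_exp_add hz hD, ← pow_mul_exp_mul_pow_mul_exp hpe z θ]; ring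
  · rw [norm_mul, Complex.norm_exp_ofReal_mul_I, mul_one, norm_pow]
    obtain ⟨k, rfl⟩ := hpe
    have hk : (k + k) / 2 = k := by omega
    rw [hk]; ring

/-- At points where the discriminant equals `2 cos (π k / m)`, the polynomial and its reversal
agree after `m` periods. -/
lemma IsSzegoPair.eval_eq_eval_rev {α : ℕ → ℂ} {φ φs : ℕ → Polynomial ℂ}
    (h : IsSzegoPair α φ φs) {p : ℕ} (hpe : Even p) (hper : ∀ n, α (n + p) = α n)
    {z : ℂ} (hz : z ≠ 0) {m k : ℕ} (hk0 : 0 < k) (hkm : k < m)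
    (hD : SzegoDisc α p z = ((2 * Real.cos (Real.pi * k / m) : ℝ) : ℂ)) :
    (φ (m * p)).eval z = (φs (m * p)).eval z ∧ (φs (m * p)).eval z ≠ 0 := by
  set θ : ℝ := Real.pi * k / m with hθ
  have hm : (0 : ℝ) < m := by exact_mod_cast hk0.trans hkm
  have hk : (0 : ℝ) < k := by exact_mod_cast hk0
  have hkm' : (k : ℝ) < m := by exact_mod_cast hkm
  have hθ0 : 0 < θ := by have := Real.pi_pos; positivity
  have hθ1 : θ < Real.pi := by
    rw [hθ, div_lt_iff₀ hm]; exact mul_lt_mul_of_pos_left hkm' Real.pi_pos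
  have hzp : z ^ (p / 2) ≠ 0 := pow_ne_zero _ hz
  set μ := z ^ (p / 2) * Complex.exp (θ * Complex.I) with hμ
  set ν := z ^ (p / 2) * Complex.exp (-(θ * Complex.I)) with hν
  have htr := trace_eq_pow_mul_exp_add hz hD
  have hprod := pow_mul_exp_mul_pow_mul_exp hpe z θ
  rw [← hμ, ← hν] at htr hprod
  have hne : μ ≠ ν := by
    intro heq
    have h1 := mul_left_cancel₀ hzp heq
    have h2 := congrArg Complex.im h1
    rw [Complex.exp_ofReal_mul_I_im, ← neg_mul, ← Complex.ofReal_neg,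
      Complex.exp_ofReal_mul_I_im, Real.sin_neg] at h2
    linarith [Real.sin_pos_of_pos_of_lt_pi hθ0 hθ1]
  have hpow : μ ^ m = ν ^ m := by
    rw [hμ, hν, mul_pow, mul_pow, ← Complex.exp_nat_mul, ← Complex.exp_nat_mul]
    congr 1
    rw [Complex.exp_eq_exp_iff_exists_int]
    refine ⟨k, ?_⟩
    have hm' : (m : ℂ) ≠ 0 := by exact_mod_cast hm.ne'
    rw [hθ]; push_cast; field_simp; ring
  have hμ0 : μ ≠ 0 := mul_ne_zero hzp (Complex.exp_ne_zero _)
  have key : ∀ y : ℕ → ℂ, y 0 = 1 → (∀ j, y (j + 2) = (SzegoT α p z).trace * y (j + 1) -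
      z ^ p * y j) → y m = μ ^ m := by
    intro y hy0 hy
    rw [eq_pow_mul_of_recurrence (y := y) (fun j => by rw [hy, htr, hprod]) hne hpow, hy0, mul_one]
  have e1 : ∀ j : ℕ, (j + 1) * p = j * p + p := fun j => by ring
  have h1 := key (fun j => (φ (j * p)).eval z) (by simp [h.zero]) fun j => by
    simp only [e1]; exact (h.eval_recurrence hper _ z).1
  have h2 := key (fun j => (φs (j * p)).eval z) (by simp [h.zero_rev]) fun j => by
    simp only [e1]; exact (h.eval_recurrence hper _ z).2
  rw [h1, h2]
  exact ⟨rfl, pow_ne_zero _ hμ0⟩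

/-- A continuous choice of phase along the unit circle of the Blaschke product with the same zeros
as `P`. -/
noncomputable def rootPhase (P : Polynomial ℂ) (x : ℝ) : ℝ :=
  (P.roots.map fun a => blaschkePhase a x).sum

lemma exp_sum_blaschkePhase (S : Multiset ℂ) (x : ℝ) :
    Complex.exp ((S.map fun a => blaschkePhase a x).sum * Complex.I) *
      (Complex.exp (x * Complex.I) ^ Multiset.card S *
        starRingEnd ℂ ((S.map fun a => Complex.exp (x * Complex.I) - a).prod)) =
      (S.map fun a => Complex.exp (x * Complex.I) - a).prod := by
  induction S using Multiset.induction with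
  | empty => simp
  | cons a S ih =>
    rw [Multiset.map_cons, Multiset.sum_cons, Multiset.map_cons, Multiset.prod_cons,
      Multiset.card_cons, Complex.ofReal_add, add_mul, Complex.exp_add, map_mul, pow_succ]
    have h := exp_blaschkePhase a x
    conv_rhs => rw [← ih, ← h]
    ring

lemma continuous_rootPhase {P : Polynomial ℂ} (h : ∀ a ∈ P.roots, ‖a‖ < 1) :
    Continuous (rootPhase P) :=
  continuous_multiset_sum _ fun _ ha => continuous_blaschkePhase (h _ ha)

lemma rootPhase_sub (P : Polynomial ℂ) (s t : ℝ) : rootPhase P t - rootPhase P s =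
    (P.roots.map fun a => blaschkePhase a t - blaschkePhase a s).sum := by
  rw [rootPhase, rootPhase, Multiset.sum_map_sub]

lemma monotone_rootPhase {P : Polynomial ℂ} (h : ∀ a ∈ P.roots, ‖a‖ < 1) :
    Monotone (rootPhase P) := fun _ _ hst =>
  Multiset.sum_map_le_sum_map _ _ fun _ ha => (strictMono_blaschkePhase (h _ ha)).monotone hst

lemma strictMono_rootPhase {P : Polynomial ℂ} (h : ∀ a ∈ P.roots, ‖a‖ < 1) (hne : P.roots ≠ 0) :
    StrictMono (rootPhase P) := by
  intro s t hst
  obtain ⟨a, ha⟩ := Multiset.exists_mem_of_ne_zero hne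
  obtain ⟨S, hS⟩ := Multiset.exists_cons_of_mem ha
  rw [rootPhase, rootPhase, hS, Multiset.map_cons, Multiset.map_cons, Multiset.sum_cons,
    Multiset.sum_cons]
  refine add_lt_add_of_lt_of_le (strictMono_blaschkePhase (h _ ha) hst) ?_
  refine Multiset.sum_map_le_sum_map _ _ fun b hb => ?_
  exact (strictMono_blaschkePhase (h _ (hS ▸ Multiset.mem_cons_of_mem hb))).monotone hst.le

lemma eq_of_continuous_of_forall_int {g : ℝ → ℝ} (hg : Continuous g)
    (hint : ∀ x, ∃ k : ℤ, g x = k) (x y : ℝ) : g x = g y := by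
  have key : ∀ x y, ¬ g x < g y := by
    intro x y hlt
    obtain ⟨k, hk⟩ := hint x
    obtain ⟨l, hl⟩ := hint y
    have hkl : k + 1 ≤ l := by rw [hk, hl] at hlt; exact_mod_cast hlt
    have hkl' : (k : ℝ) + 1 ≤ l := by exact_mod_cast hkl
    obtain ⟨z, hz⟩ := mem_range_of_exists_le_of_exists_ge hg (c := (k : ℝ) + 1 / 2)
      ⟨x, by linarith⟩ ⟨y, by linarith⟩
    obtain ⟨j, hj⟩ := hint z
    have h1 : (k : ℝ) < j := by linarith
    have h2 : (j : ℝ) < k + 1 := by linarith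
    have h1' : k < j := by exact_mod_cast h1
    have h2' : j < k + 1 := by exact_mod_cast h2
    omega
  exact le_antisymm (not_lt.1 (key y x)) (not_lt.1 (key x y))

lemma abs_blaschkePhase_sub_lt {a : ℂ} (ha : ‖a‖ < 1) (x : ℝ) :
    |blaschkePhase a x - x| < Real.pi := by
  have h := one_sub_re_pos (w := starRingEnd ℂ a * Complex.exp (x * Complex.I))
    (by rw [norm_conj_mul_exp]; exact ha)
  have := Complex.abs_arg_lt_pi_div_two_iff.2 (Or.inl h)
  rw [blaschkePhase, sub_sub_cancel_left, abs_neg, abs_mul, abs_two]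
  linarith

namespace IsSzegoPair

variable {α : ℕ → ℂ} {φ φs : ℕ → Polynomial ℂ}

lemma conj_coeff (h : IsSzegoPair α φ φs) (n : ℕ) :
    starRingEnd ℂ ((φ n).coeff n) = (φ n).coeff n := by
  induction n with
  | zero => simp [h.zero]
  | succ n ih =>
    rw [h.succ, coeff_C_mul, coeff_sub, coeff_X_mul, coeff_C_mul,
      coeff_eq_zero_of_natDegree_lt (Nat.lt_succ_of_le (h.natDegree_le n).2), mul_zero, sub_zero,
      map_mul, ih, map_inv₀, Complex.conj_ofReal]

lemma natDegree_eq (h : IsSzegoPair α φ φs) (n : ℕ) : (φ n).natDegree = n :=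
  le_antisymm (h.natDegree_le n).1 (le_natDegree_of_ne_zero (h.coeff_ne_zero n))

lemma eval_exp_eq (h : IsSzegoPair α φ φs) (n : ℕ) (x : ℝ) :
    (φ n).eval (Complex.exp (x * Complex.I)) = Complex.exp (rootPhase (φ n) x * Complex.I) *
      (φs n).eval (Complex.exp (x * Complex.I)) := by
  have h1 : ∀ z, (φ n).eval z = (φ n).coeff n * ((φ n).roots.map fun a => z - a).prod := fun z => by
    conv_lhs => rw [(IsAlgClosed.splits (φ n)).eval_eq_prod_roots]
    rw [leadingCoeff, h.natDegree_eq]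
  have h2 := exp_sum_blaschkePhase (φ n).roots x
  rw [h.card_roots] at h2
  rw [h.eval_rev_exp, h1, map_mul, h.conj_coeff, rootPhase]
  conv_lhs => rw [← h2]
  ring

lemma eval_exp_ne_zero (h : IsSzegoPair α φ φs) (n : ℕ) (x : ℝ) :
    (φ n).eval (Complex.exp (x * Complex.I)) ≠ 0 := fun h0 => by
  have := h.norm_lt_one_of_eval_eq_zero h0
  rw [Complex.norm_exp_ofReal_mul_I] at this
  exact lt_irrefl _ this

lemma eval_rev_exp_ne_zero (h : IsSzegoPair α φ φs) (n : ℕ) (x : ℝ) :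
    (φs n).eval (Complex.exp (x * Complex.I)) ≠ 0 := fun h0 => by
  refine h.eval_exp_ne_zero n x ?_
  rw [h.eval_exp_eq, h0, mul_zero]

lemma exp_rootPhase_succ (h : IsSzegoPair α φ φs) (n : ℕ) (x : ℝ) :
    Complex.exp (rootPhase (φ (n + 1)) x * Complex.I) =
      Complex.exp (blaschkePhase (starRingEnd ℂ (α n)) (x + rootPhase (φ n) x) * Complex.I) := by
  have hr : (szRho α n : ℂ) ≠ 0 := by exact_mod_cast (szRho_pos (h.norm_lt n)).ne'
  have h1 := h.eval_exp_eq (n + 1) x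
  have h1s := h.eval_rev_exp_ne_zero (n + 1) x
  have h0 := h.eval_exp_eq n x
  have h0s := h.eval_rev_exp_ne_zero n x
  have hb := exp_blaschkePhase (starRingEnd ℂ (α n)) (x + rootPhase (φ n) x)
  have hc := exp_mul_conj_exp (x + rootPhase (φ n) x)
  have hadd : Complex.exp ((x + rootPhase (φ n) x : ℝ) * Complex.I) =
      Complex.exp (x * Complex.I) * Complex.exp (rootPhase (φ n) x * Complex.I) := by
    rw [Complex.ofReal_add, add_mul, Complex.exp_add]
  rw [map_sub, Complex.conj_conj, mul_sub, hc] at hb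
  rw [hadd] at hb
  refine mul_right_cancel₀ h1s ?_
  rw [← h1, h.succ, h.succ_rev]
  simp only [eval_mul, eval_C, eval_sub, eval_X]
  rw [h0]
  linear_combination (-((szRho α n : ℂ))⁻¹ *
    eval (Complex.exp (x * Complex.I)) (φs n)) * hb

lemma rootPhase_succ_sub (h : IsSzegoPair α φ φs) (n : ℕ) (s t : ℝ) :
    rootPhase (φ (n + 1)) t - rootPhase (φ (n + 1)) s =
      blaschkePhase (starRingEnd ℂ (α n)) (t + rootPhase (φ n) t) -
      blaschkePhase (starRingEnd ℂ (α n)) (s + rootPhase (φ n) s) := by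
  have hW := fun k => continuous_rootPhase fun a => h.norm_lt_one_of_mem_roots (n := k) (a := a)
  have hb := continuous_blaschkePhase (a := starRingEnd ℂ (α n))
    (by rw [RCLike.norm_conj]; exact h.norm_lt n)
  have hpi := Real.pi_pos
  have hG := eq_of_continuous_of_forall_int (g := fun x => (rootPhase (φ (n + 1)) x -
    blaschkePhase (starRingEnd ℂ (α n)) (x + rootPhase (φ n) x)) / (2 * Real.pi))
    (((hW (n + 1)).sub (hb.comp (continuous_id.add (hW n)))).div_const _) (fun x => by
      obtain ⟨k, hk⟩ := Complex.exp_eq_exp_iff_exists_int.1 (h.exp_rootPhase_succ n x)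
      refine ⟨k, ?_⟩
      have h1 := congrArg Complex.im hk
      simp at h1
      rw [div_eq_iff (by positivity), h1]; ring) t s
  rw [div_left_inj' (by positivity)] at hG
  linarith

lemma rootPhase_succ_sub_ge (h : IsSzegoPair α φ φs) (n : ℕ) {s t : ℝ} (hst : s ≤ t) :
    rootPhase (φ n) t - rootPhase (φ n) s - 2 * Real.pi ≤
      rootPhase (φ (n + 1)) t - rootPhase (φ (n + 1)) s := by
  have ha : ‖starRingEnd ℂ (α n)‖ < 1 := by rw [RCLike.norm_conj]; exact h.norm_lt n
  have h1 := abs_lt.1 (abs_blaschkePhase_sub_lt ha (t + rootPhase (φ n) t))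
  have h2 := abs_lt.1 (abs_blaschkePhase_sub_lt ha (s + rootPhase (φ n) s))
  rw [h.rootPhase_succ_sub]
  linarith [h1.1, h2.2]

lemma rootPhase_add_sub_ge (h : IsSzegoPair α φ φs) (n b : ℕ) {s t : ℝ} (hst : s ≤ t) :
    rootPhase (φ n) t - rootPhase (φ n) s - 2 * Real.pi * b ≤
      rootPhase (φ (n + b)) t - rootPhase (φ (n + b)) s := by
  induction b with
  | zero => simp
  | succ b ih =>
    have := h.rootPhase_succ_sub_ge (n + b) hst
    rw [← add_assoc]; push_cast; linarith

end IsSzegoPair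

lemma card_sub_one_le_of_forall_int {W : ℝ → ℝ} {s t : ℝ} (hW : StrictMono W) (hst : s ≤ t)
    (F : Finset ℝ) (hF : ∀ x ∈ F, x ∈ Set.Icc s t ∧ ∃ k : ℤ, W x = k) :
    (F.card : ℝ) - 1 ≤ W t - W s := by
  have hmono := hW.monotone hst
  choose! k hk using fun x hx => (hF x hx).2
  have hcard : F.card ≤ (Finset.Icc ⌈W s⌉ ⌊W t⌋).card := by
    refine Finset.card_le_card_of_injOn k (fun x hx => ?_) fun x hx y hy hxy => ?_
    · have hx' := (hF x hx).1
      have h1 := hW.monotone hx'.1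
      have h2 := hW.monotone hx'.2
      rw [hk x hx] at h1 h2
      simpa using ⟨Int.ceil_le.2 h1, Int.le_floor.2 h2⟩
    · exact hW.injective (by rw [hk x hx, hk y hy, hxy])
  rw [Int.card_Icc] at hcard
  have h1 := Int.floor_le (W t)
  have h2 := Int.le_ceil (W s)
  rcases le_or_gt 0 (⌊W t⌋ + 1 - ⌈W s⌉) with hpos | hneg
  · have h3 : (F.card : ℤ) ≤ ⌊W t⌋ + 1 - ⌈W s⌉ := by omega
    have h4 : (F.card : ℝ) ≤ ⌊W t⌋ + 1 - ⌈W s⌉ := by exact_mod_cast h3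
    linarith
  · have h3 : F.card = 0 := by omega
    rw [h3]; push_cast; linarith

lemma IsSzegoPair.rootPhase_sub_ge {α : ℕ → ℂ} {φ φs : ℕ → Polynomial ℂ}
    (h : IsSzegoPair α φ φs) {p : ℕ} (hp : 0 < p) (hpe : Even p) (hper : ∀ n, α (n + p) = α n)
    {s t : ℝ} (hst : s ≤ t) (hsurj : ∀ c ∈ Set.Icc (-2 : ℝ) 2, ∃ x ∈ Set.Icc s t,
      SzegoDisc α p (Complex.exp (x * Complex.I)) = (c : ℂ)) (n : ℕ) :
    2 * Real.pi * ((n : ℝ) / p - (p + 3)) ≤ rootPhase (φ n) t - rootPhase (φ n) s := by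
  have hpi := Real.pi_pos
  have hp' : (0 : ℝ) < p := by exact_mod_cast hp
  set m := n / p with hm
  have hmod : m * p + n % p = n := by rw [hm, mul_comm]; exact Nat.div_add_mod n p
  have hlt : n % p < p := Nat.mod_lt _ hp
  have hnp : (n : ℝ) / p ≤ m + 1 := by
    rw [div_le_iff₀ hp']
    have : n ≤ (m + 1) * p := by rw [add_mul]; omega
    exact_mod_cast this
  have hb := h.rootPhase_add_sub_ge (m * p) (n % p) hst
  rw [hmod] at hb
  have hlt' : ((n % p : ℕ) : ℝ) ≤ p := by exact_mod_cast hlt.le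
  have key : 2 * Real.pi * ((m : ℝ) - 2) ≤
      rootPhase (φ (m * p)) t - rootPhase (φ (m * p)) s := by
    have hroots : ∀ a ∈ (φ (m * p)).roots, ‖a‖ < 1 := fun a => h.norm_lt_one_of_mem_roots
    rcases Nat.eq_zero_or_pos m with h0 | hmpos
    · have := monotone_rootPhase hroots hst
      have hm0 : (m : ℝ) = 0 := by exact_mod_cast h0
      nlinarith
    have hmpos' : (0 : ℝ) < m := by exact_mod_cast hmpos
    have hne : (φ (m * p)).roots ≠ 0 := by
      rw [← Multiset.card_pos, h.card_roots]; positivity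
    have hstrict := strictMono_rootPhase hroots hne
    choose! x hx hxD using fun k : ℕ => hsurj (2 * Real.cos (Real.pi * k / m))
      ⟨by linarith [Real.neg_one_le_cos (Real.pi * k / m)],
        by linarith [Real.cos_le_one (Real.pi * k / m)]⟩
    have hinj : Set.InjOn x (Finset.Ioo 0 m) := by
      intro k hk l hl hkl
      have h1 := hxD k
      rw [hkl, hxD l] at h1
      have h2 : Real.cos (Real.pi * l / m) = Real.cos (Real.pi * k / m) := by
        have : 2 * Real.cos (Real.pi * l / m) = 2 * Real.cos (Real.pi * k / m) := by
          exact_mod_cast h1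
        linarith
      have hmem : ∀ j ∈ (Finset.Ioo 0 m : Finset ℕ),
          Real.pi * j / m ∈ Set.Icc (0 : ℝ) Real.pi := by
        intro j hj
        have hj' : (j : ℝ) ≤ m := by exact_mod_cast (Finset.mem_Ioo.1 hj).2.le
        refine ⟨by positivity, ?_⟩
        rw [div_le_iff₀ hmpos']
        exact mul_le_mul_of_nonneg_left hj' hpi.le
      have h3 := Real.injOn_cos (hmem l hl) (hmem k hk) h2
      rw [div_left_inj' hmpos'.ne', mul_right_inj' hpi.ne'] at h3
      exact_mod_cast h3.symm
    have hcard := card_sub_one_le_of_forall_int (W := fun y => rootPhase (φ (m * p)) y /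
      (2 * Real.pi)) (s := s) (t := t)
      (fun a b hab => div_lt_div_of_pos_right (hstrict hab) (by positivity)) hst
      ((Finset.Ioo 0 m).image x) (fun y hy => by
        obtain ⟨k, hk, rfl⟩ := Finset.mem_image.1 hy
        refine ⟨hx k, ?_⟩
        obtain ⟨h1, h2⟩ := h.eval_eq_eval_rev hpe hper (Complex.exp_ne_zero _)
          (Finset.mem_Ioo.1 hk).1 (Finset.mem_Ioo.1 hk).2 (hxD k)
        rw [h.eval_exp_eq] at h1
        have h3 := mul_right_cancel₀ h2 (h1.trans (one_mul _).symm)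
        obtain ⟨j, hj⟩ := Complex.exp_eq_one_iff.1 h3
        refine ⟨j, ?_⟩
        have h4 := congrArg Complex.im hj
        simp at h4
        rw [div_eq_iff (by positivity), h4])
    rw [Finset.card_image_of_injOn hinj, Nat.card_Ioo, ← sub_div, le_div_iff₀ (by positivity)] at hcard
    have hc : ((m - 0 - 1 : ℕ) : ℝ) = m - 1 := by
      rw [Nat.sub_zero, Nat.cast_sub hmpos]; simp
    rw [hc] at hcard
    linarith
  have h1 : 2 * Real.pi * ((n : ℝ) / p - (p + 3)) ≤ 2 * Real.pi * (m - 2 - (n % p : ℕ)) :=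
    mul_le_mul_of_nonneg_left (by linarith) (by positivity)
  nlinarith

lemma exp_arg_add_mul_I {w : ℂ} (hw : ‖w‖ = 1) (y : ℝ) :
    Complex.exp (((w * Complex.exp (-(y * Complex.I))).arg + y : ℝ) * Complex.I) = w := by
  have h := Complex.norm_mul_exp_arg_mul_I (w * Complex.exp (-(y * Complex.I)))
  rw [norm_mul, hw, ← neg_mul, ← Complex.ofReal_neg, Complex.norm_exp_ofReal_mul_I] at h
  rw [Complex.ofReal_add, add_mul, Complex.exp_add, ← neg_mul, ← Complex.ofReal_neg]
  simp only [mul_one, Complex.ofReal_one, one_mul] at h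
  rw [h, mul_assoc, ← Complex.exp_add]; simp

/-- A compact connected subset of the circle missing a point is a closed arc. -/
lemma exists_arc_of_isCompact_isConnected {K : Set ℂ} (hK : IsCompact K) (hc : IsConnected K)
    (hnorm : ∀ w ∈ K, ‖w‖ = 1) {θ₀ : ℝ} (hθ : Complex.exp (θ₀ * Complex.I) ∉ K) :
    ∃ s t : ℝ, s ≤ t ∧ θ₀ < s ∧ t < θ₀ + 2 * Real.pi ∧
      ∀ w, w ∈ K ↔ ∃ x ∈ Set.Icc s t, w = Complex.exp (x * Complex.I) := by
  set y := θ₀ + Real.pi with hy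
  set g : ℂ → ℝ := fun w => (w * Complex.exp (-(y * Complex.I))).arg + y with hg
  have hexp : ∀ w ∈ K, Complex.exp (g w * Complex.I) = w := fun w hw =>
    exp_arg_add_mul_I (hnorm w hw) y
  have hne : ∀ w ∈ K, (w * Complex.exp (-(y * Complex.I))).arg ≠ Real.pi := by
    intro w hw h
    apply hθ
    have := hexp w hw
    rw [hg] at this
    simp only [h] at this
    have h2 : ((Real.pi + y : ℝ) : ℂ) * Complex.I = θ₀ * Complex.I + 2 * Real.pi * Complex.I := by
      rw [hy]; push_cast; ring
    rw [h2, Complex.exp_add, Complex.exp_two_pi_mul_I, mul_one] at this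
    rwa [this]
  have hcont : ContinuousOn g K := by
    intro w hw
    refine ContinuousAt.continuousWithinAt (ContinuousAt.add ?_ continuousAt_const)
    refine ContinuousAt.comp (g := Complex.arg) (f := fun w => w * Complex.exp (-(y * Complex.I)))
      (Complex.continuousAt_arg ?_) (by fun_prop)
    refine Complex.mem_slitPlane_iff_arg.2 ⟨hne w hw, mul_ne_zero ?_ (Complex.exp_ne_zero _)⟩
    rw [← norm_pos_iff, hnorm w hw]; exact one_pos
  have himg := eq_Icc_of_connected_compact (hc.image g hcont) (hK.image_of_continuousOn hcont)
  set s := sInf (g '' K)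
  set t := sSup (g '' K)
  obtain ⟨w₀, hw₀⟩ := hc.nonempty
  have hst : s ≤ t := by
    have : g w₀ ∈ Set.Icc s t := himg ▸ Set.mem_image_of_mem g hw₀
    exact this.1.trans this.2
  have hrange : ∀ x ∈ Set.Icc s t, θ₀ < x ∧ x < θ₀ + 2 * Real.pi ∧
      Complex.exp (x * Complex.I) ∈ K := by
    intro x hx
    rw [← himg] at hx
    obtain ⟨w, hw, rfl⟩ := hx
    rw [hexp w hw]
    have h1 := Complex.neg_pi_lt_arg (w * Complex.exp (-(y * Complex.I)))
    have h2 := lt_of_le_of_ne (Complex.arg_le_pi (w * Complex.exp (-(y * Complex.I)))) (hne w hw)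
    exact ⟨by simp only [hg]; linarith, by simp only [hg]; linarith, hw⟩
  refine ⟨s, t, hst, (hrange s ⟨le_rfl, hst⟩).1, (hrange t ⟨hst, le_rfl⟩).2.1, fun w =>
    ⟨fun hw => ⟨g w, himg ▸ Set.mem_image_of_mem g hw, (hexp w hw).symm⟩, ?_⟩⟩
  rintro ⟨x, hx, rfl⟩
  exact (hrange x hx).2.2

lemma continuous_exp_mul_I : Continuous fun x : ℝ => Complex.exp (x * Complex.I) := by fun_prop

lemma tendsto_exp_mul_I_nhdsNE (x : ℝ) :
    Filter.Tendsto (fun x : ℝ => Complex.exp (x * Complex.I)) (nhdsWithin x {x}ᶜ)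
      (nhdsWithin (Complex.exp (x * Complex.I)) {Complex.exp (x * Complex.I)}ᶜ) := by
  have hd : HasDerivAt (fun y : ℝ => Complex.exp (y * Complex.I))
      (Complex.exp (x * Complex.I) * Complex.I) x := by
    have h := (((hasDerivAt_id (x : ℂ)).mul_const Complex.I).cexp).comp_ofReal
    simpa using h
  exact hd.tendsto_nhdsNE (mul_ne_zero (Complex.exp_ne_zero _) Complex.I_ne_zero)

section RealOnCircle

variable {F : ℂ → ℂ} (hF : ∀ z, z ≠ 0 → AnalyticAt ℂ F z)
  (hreal : ∀ x : ℝ, F (Complex.exp (x * Complex.I)) =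
    ((F (Complex.exp (x * Complex.I))).re : ℂ))
  (hcirc : ∀ z, z ≠ 0 → ∀ c ∈ Set.Icc (-2 : ℝ) 2, F z = (c : ℂ) → ‖z‖ = 1)

include hcirc in
lemma not_eventually_eq_of_mem_Icc {c : ℝ} (hc : c ∈ Set.Icc (-2 : ℝ) 2) {z : ℂ} (hz : z ≠ 0) :
    ¬ ∀ᶠ w in nhds z, F w = (c : ℂ) := by
  intro h
  have h1 : ∀ᶠ w in nhds z, ‖w‖ = 1 := by
    filter_upwards [h, isOpen_ne.mem_nhds hz] with w hw hw0 using hcirc w hw0 c hc hw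
  have hz1 : ‖z‖ = 1 := h1.self_of_nhds
  have ht : Filter.Tendsto (fun r : ℝ => (r : ℂ) * z) (nhds 1) (nhds z) := by
    have : Continuous fun r : ℝ => (r : ℂ) * z := by fun_prop
    simpa using this.tendsto 1
  obtain ⟨ε, hε, hball⟩ := Metric.eventually_nhds_iff.1 (ht.eventually h1)
  have := @hball (1 + ε / 2) (by rw [Real.dist_eq]; rw [add_sub_cancel_left, abs_of_pos (half_pos hε)]; linarith)
  rw [norm_mul, hz1, mul_one, Complex.norm_real, Real.norm_of_nonneg (by linarith)] at this
  linarith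

include hF hreal hcirc in
/-- A value of the discriminant in `(-2, 2]` is never a minimum over a band. -/
lemma exists_uIcc_lt {x : ℝ} (hx : (F (Complex.exp (x * Complex.I))).re ∈ Set.Ioc (-2 : ℝ) 2) :
    ∃ x₁ : ℝ, (F (Complex.exp (x₁ * Complex.I))).re < (F (Complex.exp (x * Complex.I))).re ∧
      ∀ y ∈ Set.uIcc x x₁, (F (Complex.exp (y * Complex.I))).re ∈ Set.Icc (-2 : ℝ) 2 := by
  set D : ℝ → ℝ := fun y => (F (Complex.exp (y * Complex.I))).re with hD
  have hDc : Continuous D := by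
    refine Complex.continuous_re.comp (continuous_iff_continuousAt.2 fun y => ?_)
    exact ContinuousAt.comp (hF _ (Complex.exp_ne_zero _)).continuousAt
      continuous_exp_mul_I.continuousAt
  change D x ∈ Set.Ioc (-2 : ℝ) 2 at hx
  change ∃ x₁, D x₁ < D x ∧ ∀ y ∈ Set.uIcc x x₁, D y ∈ Set.Icc (-2 : ℝ) 2
  set z := Complex.exp (x * Complex.I) with hz
  have hz0 : z ≠ 0 := Complex.exp_ne_zero _
  have hFz : F z = (D x : ℂ) := hreal x
  have hnot := not_eventually_eq_of_mem_Icc hcirc (Set.Ioc_subset_Icc_self hx) hz0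
  have hne : ∀ᶠ y in nhdsWithin x {x}ᶜ, D y ≠ D x := by
    have h1 := ((hF z hz0).eventually_eq_or_eventually_ne
      (analyticAt_const (v := (D x : ℂ)))).resolve_left hnot
    filter_upwards [(tendsto_exp_mul_I_nhdsNE x).eventually h1] with y hy hyx
    exact hy (by rw [hreal y, ← hyx])
  have hgt : ∀ᶠ y in nhds x, -2 < D y := hDc.continuousAt.eventually (lt_mem_nhds hx.1)
  rw [eventually_nhdsWithin_iff] at hne
  obtain ⟨η, hη, hball⟩ := Metric.eventually_nhds_iff.1 (hne.and hgt)
  have hopen := ((hF z hz0).eventually_constant_or_nhds_le_map_nhds).resolve_left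
    (by rw [hFz]; exact hnot)
  have harg : ∀ᶠ w in nhds z, |(w * Complex.exp (-(x * Complex.I))).arg| < η := by
    have h1 : z * Complex.exp (-(x * Complex.I)) = 1 := by
      rw [hz, ← Complex.exp_add]; simp
    have hcont : ContinuousAt (fun w => |(w * Complex.exp (-(x * Complex.I))).arg|) z := by
      refine ContinuousAt.abs (ContinuousAt.comp (g := Complex.arg)
        (f := fun w => w * Complex.exp (-(x * Complex.I))) (Complex.continuousAt_arg ?_)
        (by fun_prop))
      rw [h1]; exact Complex.one_mem_slitPlane
    refine hcont.eventually (gt_mem_nhds ?_)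
    simpa [h1] using hη
  have himg : F '' {w | |(w * Complex.exp (-(x * Complex.I))).arg| < η ∧ w ≠ 0} ∈ nhds (F z) :=
    hopen (Filter.image_mem_map (Filter.inter_mem harg (isOpen_ne.mem_nhds hz0)))
  rw [hFz] at himg
  have hval : ∀ᶠ v : ℝ in nhds (D x),
      (v : ℂ) ∈ F '' {w | |(w * Complex.exp (-(x * Complex.I))).arg| < η ∧ w ≠ 0} :=
    Complex.continuous_ofReal.continuousAt.eventually himg
  have hlt : ∃ᶠ v in nhds (D x), v < D x := frequently_lt_nhds (D x)
  obtain ⟨v, hvlt, ⟨w, ⟨hwarg, hw0⟩, hwv⟩, hv2⟩ :=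
    (hlt.and_eventually (hval.and (lt_mem_nhds hx.1))).exists
  have hw1 : ‖w‖ = 1 := hcirc w hw0 v ⟨hv2.le, hvlt.le.trans hx.2⟩ hwv
  have hwx := exp_arg_add_mul_I hw1 x
  set x₁ := (w * Complex.exp (-(x * Complex.I))).arg + x with hx₁
  have hDx₁ : D x₁ = v := by simp only [hD]; rw [hwx, hwv, Complex.ofReal_re]
  have hdist : |x₁ - x| < η := by rw [hx₁, add_sub_cancel_right]; exact hwarg
  refine ⟨x₁, by rw [hDx₁]; exact hvlt, fun y hy => ?_⟩
  have hsub : ∀ u ∈ Set.uIcc x x₁, |u - x| < η := fun u hu =>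
    (Set.abs_sub_left_of_mem_uIcc hu).trans_lt hdist
  obtain ⟨hy1, hy2⟩ := hball (y := y) (by rw [Real.dist_eq]; exact hsub y hy)
  refine ⟨hy2.le, ?_⟩
  by_contra hcon
  push Not at hcon
  have hyx : y ≠ x := by rintro rfl; linarith [hx.2]
  have hmem : D x ∈ Set.uIcc (D x₁) (D y) := by
    rw [Set.mem_uIcc]; left; exact ⟨by rw [hDx₁]; exact hvlt.le, hx.2.trans hcon.le⟩
  obtain ⟨u, hu, hux⟩ := intermediate_value_uIcc hDc.continuousOn hmem
  have hux' : u ≠ x := by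
    rintro rfl
    rw [Set.mem_uIcc] at hu hy
    rcases hu with hu | hu <;> rcases hy with hy | hy <;>
      exact hyx (le_antisymm (by linarith) (by linarith))
  have hu' : u ∈ Set.uIcc x x₁ := Set.uIcc_subset_uIcc Set.right_mem_uIcc hy hu
  exact (hball (y := u) (by rw [Real.dist_eq]; exact hsub u hu')).1 hux' hux

include hF hreal hcirc in
lemma exists_eq_neg_two_of_component {s t : ℝ} (hst : s ≤ t) {z : ℂ}
    (hK : ∀ w, w ∈ connectedComponentIn
        {z : ℂ | ‖z‖ = 1 ∧ ∃ t : ℝ, t ∈ Set.Icc (-2 : ℝ) 2 ∧ F z = (t : ℂ)} z ↔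
      ∃ x ∈ Set.Icc s t, w = Complex.exp (x * Complex.I)) :
    ∃ x ∈ Set.Icc s t, (F (Complex.exp (x * Complex.I))).re = -2 := by
  set S := {z : ℂ | ‖z‖ = 1 ∧ ∃ t : ℝ, t ∈ Set.Icc (-2 : ℝ) 2 ∧ F z = (t : ℂ)} with hS
  have hDc : Continuous fun y : ℝ => (F (Complex.exp (y * Complex.I))).re := by
    refine Complex.continuous_re.comp (continuous_iff_continuousAt.2 fun y => ?_)
    exact ContinuousAt.comp (hF _ (Complex.exp_ne_zero _)).continuousAt
      continuous_exp_mul_I.continuousAt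
  have hbd : ∀ x ∈ Set.Icc s t, (F (Complex.exp (x * Complex.I))).re ∈ Set.Icc (-2 : ℝ) 2 := by
    intro x hx
    obtain ⟨-, c, hc, hc'⟩ := connectedComponentIn_subset _ _ ((hK _).2 ⟨x, hx, rfl⟩)
    rwa [hc', Complex.ofReal_re]
  obtain ⟨x, hx, hmin⟩ := isCompact_Icc.exists_isMinOn (Set.nonempty_Icc.2 hst) hDc.continuousOn
  refine ⟨x, hx, ?_⟩
  by_contra hcon
  obtain ⟨x₁, hlt, hseg⟩ := exists_uIcc_lt hF hreal hcirc
    (x := x) ⟨lt_of_le_of_ne (hbd x hx).1 (Ne.symm hcon), (hbd x hx).2⟩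
  have hpre : IsPreconnected ((fun y : ℝ => Complex.exp (y * Complex.I)) '' Set.uIcc x x₁) :=
    isPreconnected_uIcc.image _ continuous_exp_mul_I.continuousOn
  have hsub := hpre.subset_connectedComponentIn (F := S)
    (Set.mem_image_of_mem _ Set.left_mem_uIcc) (by
      rintro _ ⟨y, hy, rfl⟩
      exact ⟨Complex.norm_exp_ofReal_mul_I y, _, hseg y hy, hreal y⟩)
  rw [← connectedComponentIn_eq ((hK _).2 ⟨x, hx, rfl⟩)] at hsub
  obtain ⟨y, hy, hyx⟩ := (hK _).1 (hsub (Set.mem_image_of_mem _ Set.right_mem_uIcc))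
  have := hmin hy
  simp only [Set.mem_ofPred_eq] at this
  rw [← hyx] at this
  linarith

include hF hreal hcirc in
lemma exists_eq_of_component {s t : ℝ} (hst : s ≤ t) {z : ℂ}
    (hK : ∀ w, w ∈ connectedComponentIn
        {z : ℂ | ‖z‖ = 1 ∧ ∃ t : ℝ, t ∈ Set.Icc (-2 : ℝ) 2 ∧ F z = (t : ℂ)} z ↔
      ∃ x ∈ Set.Icc s t, w = Complex.exp (x * Complex.I)) :
    ∀ c ∈ Set.Icc (-2 : ℝ) 2, ∃ x ∈ Set.Icc s t, F (Complex.exp (x * Complex.I)) = (c : ℂ) := by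
  intro c hc
  have hDc : Continuous fun y : ℝ => (F (Complex.exp (y * Complex.I))).re := by
    refine Complex.continuous_re.comp (continuous_iff_continuousAt.2 fun y => ?_)
    exact ContinuousAt.comp (hF _ (Complex.exp_ne_zero _)).continuousAt
      continuous_exp_mul_I.continuousAt
  obtain ⟨x, hx, hxD⟩ := exists_eq_neg_two_of_component hF hreal hcirc hst hK
  have hset : {z : ℂ | ‖z‖ = 1 ∧ ∃ t : ℝ, t ∈ Set.Icc (-2 : ℝ) 2 ∧ F z = (t : ℂ)} =
      {z : ℂ | ‖z‖ = 1 ∧ ∃ t : ℝ, t ∈ Set.Icc (-2 : ℝ) 2 ∧ -F z = (t : ℂ)} := by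
    ext w
    refine and_congr_right fun _ => ⟨?_, ?_⟩
    · rintro ⟨u, hu, h⟩
      exact ⟨-u, ⟨by linarith [hu.2], by linarith [hu.1]⟩, by rw [h]; push_cast; rfl⟩
    · rintro ⟨u, hu, h⟩
      exact ⟨-u, ⟨by linarith [hu.2], by linarith [hu.1]⟩, by rw [← neg_neg (F w), h]; push_cast; rfl⟩
  rw [hset] at hK
  obtain ⟨y, hy, hyD⟩ := exists_eq_neg_two_of_component (F := fun w => -F w)
    (fun w hw => (hF w hw).neg) (fun u => by
      conv_lhs => rw [hreal u]
      simp) (fun w hw u hu h => hcirc w hw (-u) ⟨by linarith [hu.2], by linarith [hu.1]⟩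
        (by rw [← neg_neg (F w), h]; push_cast; rfl)) hst hK
  have hyD' : (F (Complex.exp (y * Complex.I))).re = 2 := by
    rw [Complex.neg_re] at hyD; linarith
  obtain ⟨u, hu, huc⟩ := isPreconnected_Icc.intermediate_value hx hy hDc.continuousOn
    (show c ∈ Set.Icc _ _ by rw [hxD, hyD']; exact hc)
  exact ⟨u, hu, by rw [hreal u]; simp only at huc; rw [huc]⟩

end RealOnCircle

lemma analyticAt_szegoDisc (α : ℕ → ℂ) (p : ℕ) {z : ℂ} (hz : z ≠ 0) :
    AnalyticAt ℂ (SzegoDisc α p) z := by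
  obtain ⟨P, hP⟩ := trace_szegoT_polynomial α p
  have h : SzegoDisc α p = fun z => (z ^ (p / 2))⁻¹ * P.eval z := by
    ext w; rw [SzegoDisc, hP]
  rw [h]
  exact ((analyticAt_id.pow _).inv (pow_ne_zero _ hz)).mul (P.differentiable.analyticAt z)

lemma isClosed_szBandSet (α : ℕ → ℂ) (p : ℕ) : IsClosed (szBandSet α p) := by
  have hcont : ContinuousOn (SzegoDisc α p) (Metric.sphere 0 1) := fun z hz =>
    (analyticAt_szegoDisc α p (by rintro rfl; simp at hz)).continuousAt.continuousWithinAt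
  have h : szBandSet α p = Metric.sphere 0 1 ∩
      SzegoDisc α p ⁻¹' ((fun t : ℝ => (t : ℂ)) '' Set.Icc (-2) 2) := by
    ext z
    simp [szBandSet, eq_comm]
  rw [h]
  exact hcont.preimage_isClosed_of_isClosed Metric.isClosed_sphere
    (isCompact_Icc.image Complex.continuous_ofReal).isClosed

lemma isCompact_of_szIsBand {α : ℕ → ℂ} {p : ℕ} {B : Set ℂ} (hB : szIsBand α p B) :
    IsCompact B := by
  obtain ⟨z, hz, rfl⟩ := hB
  have hsub := connectedComponentIn_subset (szBandSet α p) z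
  have hclosed : IsClosed (connectedComponentIn (szBandSet α p) z) := by
    refine isClosed_of_closure_subset ?_
    refine isPreconnected_connectedComponentIn.closure.subset_connectedComponentIn
      (subset_closure (mem_connectedComponentIn hz)) ?_
    exact closure_minimal hsub (isClosed_szBandSet α p)
  refine (isCompact_sphere (0 : ℂ) 1).of_isClosed_subset hclosed fun w hw => ?_
  simpa using (hsub hw).1

lemma szIsBand_eq_of_mem {α : ℕ → ℂ} {p : ℕ} {B B' : Set ℂ} (hB : szIsBand α p B)
    (hB' : szIsBand α p B') {w : ℂ} (hw : w ∈ B) (hw' : w ∈ B') : B = B' := by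
  obtain ⟨z, hz, rfl⟩ := hB
  obtain ⟨z', hz', rfl⟩ := hB'
  rw [connectedComponentIn_eq hw, connectedComponentIn_eq hw']

/-- If there is more than one band, the band set omits a point of the circle. -/
lemma exists_not_mem_szBandSet {α : ℕ → ℂ} {p : ℕ}
    (h : 1 < {B : Set ℂ | szIsBand α p B}.ncard) :
    ∃ θ₀ : ℝ, Complex.exp (θ₀ * Complex.I) ∉ szBandSet α p := by
  by_contra hcon
  push Not at hcon
  obtain ⟨B, hB, B', hB', hne⟩ := (Set.one_lt_ncard (Set.finite_of_ncard_pos (by omega))).1 h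
  have hpre : IsPreconnected (szBandSet α p) := by
    have hr : szBandSet α p = Set.range fun x : ℝ => Complex.exp (x * Complex.I) := by
      refine Set.Subset.antisymm (fun z hz => ⟨z.arg, ?_⟩) ?_
      · have := Complex.norm_mul_exp_arg_mul_I z
        rw [hz.1] at this
        simpa using this
      · rintro _ ⟨x, rfl⟩; exact hcon x
    rw [hr]
    exact isPreconnected_range continuous_exp_mul_I
  apply hne
  obtain ⟨z, hz, rfl⟩ := hB
  obtain ⟨z', hz', rfl⟩ := hB'
  rw [hpre.connectedComponentIn hz, hpre.connectedComponentIn hz']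

/-- Every band is a closed arc on which the discriminant attains all values in `[-2, 2]`. -/
lemma exists_arc_of_szIsBand {α : ℕ → ℂ} (h : ∀ n, ‖α n‖ < 1) {p : ℕ} (hp : 0 < p)
    (hpe : Even p) {θ₀ : ℝ} (hθ : Complex.exp (θ₀ * Complex.I) ∉ szBandSet α p)
    {B : Set ℂ} (hB : szIsBand α p B) :
    ∃ s t : ℝ, s ≤ t ∧ θ₀ < s ∧ t < θ₀ + 2 * Real.pi ∧
      (∀ w, w ∈ B ↔ ∃ x ∈ Set.Icc s t, w = Complex.exp (x * Complex.I)) ∧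
      ∀ c ∈ Set.Icc (-2 : ℝ) 2, ∃ x ∈ Set.Icc s t,
        SzegoDisc α p (Complex.exp (x * Complex.I)) = (c : ℂ) := by
  have hcpt := isCompact_of_szIsBand hB
  obtain ⟨z, hz, rfl⟩ := hB
  have hsub := connectedComponentIn_subset (szBandSet α p) z
  obtain ⟨s, t, hst, hs, ht, hmem⟩ := exists_arc_of_isCompact_isConnected hcpt
    (isConnected_connectedComponentIn_iff.2 hz) (fun w hw => (hsub hw).1) fun hw => hθ (hsub hw)
  exact ⟨s, t, hst, hs, ht, hmem, exists_eq_of_component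
    (fun w hw => analyticAt_szegoDisc α p hw)
    (fun x => szegoDisc_real_of_norm_eq_one α hpe (Complex.norm_exp_ofReal_mul_I x))
    (fun w hw c hc hD => norm_eq_one_of_szegoDisc h hp hpe hw hc hD) hst hmem⟩

lemma sum_phase_bound {ι : Type*} {S : Finset ι} {s t : ι → ℝ} {M : ℝ} {Q : ι → ℂ → Prop}
    [∀ i, DecidablePred (Q i)]
    (hM : ∀ a : ℂ, ‖a‖ < 1 →
      1 - ‖a‖ ≤ M * (2 * Real.pi - ∑ i ∈ S, (blaschkePhase a (t i) - blaschkePhase a (s i))) ∧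
      ∀ i ∈ S, blaschkePhase a (t i) - blaschkePhase a (s i) ≤
        2 * Real.pi * (if Q i a then 1 else 0) +
        M * (2 * Real.pi - ∑ i ∈ S, (blaschkePhase a (t i) - blaschkePhase a (s i))))
    (R : Multiset ℂ) (hR : ∀ a ∈ R, ‖a‖ < 1) :
    (R.map fun a => 1 - ‖a‖).sum ≤ M * (2 * Real.pi * Multiset.card R - ∑ i ∈ S,
        (R.map fun a => blaschkePhase a (t i) - blaschkePhase a (s i)).sum) ∧
      ∀ i ∈ S, (R.map fun a => blaschkePhase a (t i) - blaschkePhase a (s i)).sum ≤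
        2 * Real.pi * Multiset.card (R.filter (Q i)) + M * (2 * Real.pi * Multiset.card R -
          ∑ i ∈ S, (R.map fun a => blaschkePhase a (t i) - blaschkePhase a (s i)).sum) := by
  induction R using Multiset.induction with
  | empty => simp
  | cons a R ih =>
    obtain ⟨ih1, ih2⟩ := ih fun b hb => hR b (Multiset.mem_cons_of_mem hb)
    obtain ⟨h1, h2⟩ := hM a (hR a (Multiset.mem_cons_self a R))
    simp only [Multiset.map_cons, Multiset.sum_cons, Multiset.card_cons, Finset.sum_add_distrib]
    push_cast
    refine ⟨by linarith, fun i hi => ?_⟩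
    have h3 := ih2 i hi
    have h4 := h2 i hi
    by_cases hq : Q i a
    · rw [Multiset.filter_cons_of_pos _ hq, Multiset.card_cons]
      rw [if_pos hq] at h4
      push_cast
      linarith
    · rw [Multiset.filter_cons_of_neg _ hq]
      rw [if_neg hq] at h4
      linarith

open scoped Classical in
/-- The zeros of the orthonormal polynomials accumulate on the circle with bounded total defect, and
each band sector contains at least `n / p` of them up to a bounded error. -/
lemma IsSzegoPair.exists_sector_bound {α : ℕ → ℂ} {φ φs : ℕ → Polynomial ℂ}
    (h : IsSzegoPair α φ φs) {p : ℕ} (hp : 0 < p) (hpe : Even p) (hper : ∀ n, α (n + p) = α n)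
    (hgaps : {B : Set ℂ | szIsBand α p B}.ncard = p) :
    ∃ K : ℝ, 0 < K ∧ ∀ n, ((φ n).roots.map fun a => 1 - ‖a‖).sum ≤ K ∧
      ∀ B, szIsBand α p B → (n : ℝ) / p - K ≤ Multiset.card ((φ n).roots.filter
        fun a => a ≠ 0 ∧ a / (‖a‖ : ℂ) ∈ B) := by
  have hpi := Real.pi_pos
  have hp' : (0 : ℝ) < p := by exact_mod_cast hp
  have hp2 : 1 < p := by obtain ⟨k, rfl⟩ := hpe; omega
  obtain ⟨θ₀, hθ⟩ := exists_not_mem_szBandSet (α := α) (p := p) (by rw [hgaps]; exact hp2)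
  have hfin : {B : Set ℂ | szIsBand α p B}.Finite := Set.finite_of_ncard_pos (by omega)
  choose! s t hst hs ht hmem hsurj using fun B (hB : szIsBand α p B) =>
    exists_arc_of_szIsBand h.norm_lt hp hpe hθ hB
  have hS : ∀ B, B ∈ hfin.toFinset ↔ szIsBand α p B := fun B => by simp
  have hcard : hfin.toFinset.card = p := by rw [← Set.ncard_eq_toFinset_card _ hfin, hgaps]
  obtain ⟨M, hM0, hM⟩ := exists_pointwise_phase_bound hfin.toFinset s t
    (fun B hB => hst B ((hS B).1 hB)) (fun B hB => hs B ((hS B).1 hB))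
    (fun B hB => ht B ((hS B).1 hB)) (fun B hB B' hB' hne => by
      rw [Set.disjoint_left]
      intro x hx hx'
      rw [hS] at hB hB'
      exact hne (szIsBand_eq_of_mem hB hB' ((hmem B hB _).2 ⟨x, hx, rfl⟩)
        ((hmem B' hB' _).2 ⟨x, hx', rfl⟩)))
  set E : ℝ := 2 * Real.pi * (p * (p + 3)) with hE
  refine ⟨(p + 3) + M * E + M * (p * (p + 3)), by positivity, fun n => ?_⟩
  have hrot : ∀ B, szIsBand α p B → 2 * Real.pi * ((n : ℝ) / p - (p + 3)) ≤
      ((φ n).roots.map fun a => blaschkePhase a (t B) - blaschkePhase a (s B)).sum := by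
    intro B hB
    rw [← rootPhase_sub]
    exact h.rootPhase_sub_ge hp hpe hper (hst B hB) (hsurj B hB) n
  have htot : 2 * Real.pi * (Multiset.card (φ n).roots : ℝ) - ∑ B ∈ hfin.toFinset,
      ((φ n).roots.map fun a => blaschkePhase a (t B) - blaschkePhase a (s B)).sum ≤ E := by
    have h1 := Finset.card_nsmul_le_sum hfin.toFinset _ _ fun B hB => hrot B ((hS B).1 hB)
    rw [hcard, nsmul_eq_mul] at h1
    rw [h.card_roots]
    have h2 : (p : ℝ) * (2 * Real.pi * ((n : ℝ) / p - (p + 3))) = 2 * Real.pi * n - E := by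
      rw [hE]; field_simp
    linarith
  obtain ⟨h1, h2⟩ := sum_phase_bound (Q := fun B a => a ≠ 0 ∧ ∃ x ∈ Set.Icc (s B) (t B),
    a = ‖a‖ * Complex.exp (x * Complex.I)) hM (φ n).roots fun a => h.norm_lt_one_of_mem_roots
  have hME := mul_le_mul_of_nonneg_left htot hM0.le
  refine ⟨?_, fun B hB => ?_⟩
  · have : 0 < M * (p * (p + 3) : ℝ) := by positivity
    linarith
  · have h3 := h2 B ((hS B).2 hB)
    have h4 := hrot B hB
    have h5 : (φ n).roots.filter (fun a => a ≠ 0 ∧ a / (‖a‖ : ℂ) ∈ B) =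
        (φ n).roots.filter fun a => a ≠ 0 ∧ ∃ x ∈ Set.Icc (s B) (t B),
          a = ‖a‖ * Complex.exp (x * Complex.I) := by
      refine Multiset.filter_congr fun a _ => and_congr_right fun ha => ?_
      have ha' : (‖a‖ : ℂ) ≠ 0 := by exact_mod_cast norm_ne_zero_iff.2 ha
      simp only [hmem B hB, div_eq_iff ha', mul_comm]
    rw [h5]
    have h6 : 2 * Real.pi * ((n : ℝ) / p - (p + 3)) - M * E ≤ 2 * Real.pi *
        Multiset.card ((φ n).roots.filter fun a => a ≠ 0 ∧ ∃ x ∈ Set.Icc (s B) (t B),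
          a = ‖a‖ * Complex.exp (x * Complex.I)) := by linarith
    have h7 : M * E = 2 * Real.pi * (M * (p * (p + 3))) := by rw [hE]; ring
    rw [h7, ← mul_sub, mul_le_mul_iff_right₀ (by positivity)] at h6
    have : 0 < M * E := by positivity
    linarith

lemma exists_pos_le_one_sub_norm (R : Multiset ℂ) :
    ∃ c : ℝ, 0 < c ∧ c ≤ 1 ∧ ∀ w ∈ R, ‖w‖ < 1 → c ≤ 1 - ‖w‖ := by
  induction R using Multiset.induction with
  | empty => exact ⟨1, one_pos, le_rfl, by simp⟩
  | cons a R ih =>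
    obtain ⟨c, hc, hc1, hR⟩ := ih
    rcases lt_or_ge ‖a‖ 1 with ha | ha
    · refine ⟨min c (1 - ‖a‖), lt_min hc (by linarith), (min_le_left _ _).trans hc1, ?_⟩
      intro w hw hw1
      rcases Multiset.mem_cons.1 hw with rfl | hw
      · exact min_le_right _ _
      · exact (min_le_left _ _).trans (hR w hw hw1)
    · refine ⟨c, hc, hc1, fun w hw hw1 => ?_⟩
      rcases Multiset.mem_cons.1 hw with rfl | hw
      · linarith
      · exact hR w hw hw1

lemma pow_card_le_norm_prod {δ : ℝ} (hδ : 0 ≤ δ) (z : ℂ) (R : Multiset ℂ)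
    (h : ∀ w ∈ R, δ ≤ ‖z - w‖) : δ ^ Multiset.card R ≤ ‖(R.map fun w => z - w).prod‖ := by
  induction R using Multiset.induction with
  | empty => simp
  | cons a R ih =>
    rw [Multiset.map_cons, Multiset.prod_cons, norm_mul, Multiset.card_cons, pow_succ']
    exact mul_le_mul (h a (Multiset.mem_cons_self a R))
      (ih fun w hw => h w (Multiset.mem_cons_of_mem hw)) (pow_nonneg hδ _) (norm_nonneg _)

/-- Inside the disc and near the circle, a nonzero polynomial is at least a constant times a power
of the distance to the circle. -/
lemma exists_pow_le_norm_eval (Q : Polynomial ℂ) :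
    ∃ c : ℝ, 0 < c ∧ ∀ z : ℂ, ‖z‖ ≤ 1 → 1 - ‖z‖ ≤ c →
      ‖Q.leadingCoeff‖ * (1 - ‖z‖) ^ Q.natDegree ≤ ‖Q.eval z‖ := by
  obtain ⟨c, hc, -, hR⟩ := exists_pos_le_one_sub_norm Q.roots
  refine ⟨c / 2, by positivity, fun z hz hzc => ?_⟩
  rw [(IsAlgClosed.splits Q).eval_eq_prod_roots, norm_mul, ← IsAlgClosed.card_roots_eq_natDegree]
  refine mul_le_mul_of_nonneg_left ?_ (norm_nonneg _)
  refine pow_card_le_norm_prod (by linarith) z _ fun w hw => ?_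
  rcases lt_or_ge ‖w‖ 1 with hw1 | hw1
  · have := hR w hw hw1
    have := norm_sub_norm_le z w
    linarith
  · have := norm_sub_norm_le w z
    rw [norm_sub_rev] at this
    linarith

lemma exists_norm_eval_le (P : Polynomial ℂ) : ∃ L : ℝ, 0 ≤ L ∧ ∀ z : ℂ, ‖z‖ ≤ 1 →
    ‖P.eval z‖ ≤ L := by
  obtain ⟨L, hL⟩ := (isCompact_closedBall (0 : ℂ) 1).exists_bound_of_continuousOn
    (f := fun z => P.eval z) P.continuous.continuousOn
  have h : ∀ z : ℂ, ‖z‖ ≤ 1 → ‖P.eval z‖ ≤ L := fun z hz => hL z (by simpa using hz)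
  exact ⟨L, (norm_nonneg _).trans (h 0 (by simp)), h⟩

/-- Inside the disc, the two eigenvalues of the monodromy matrix have separated moduli. -/
lemma exists_eigenvalues {α : ℕ → ℂ} (h : ∀ n, ‖α n‖ < 1) {p : ℕ} (hp : 0 < p) {z : ℂ}
    (hz0 : z ≠ 0) (hz : ‖z‖ ≤ 1) :
    ∃ μ ν : ℂ, μ + ν = (SzegoT α p z).trace ∧ μ * ν = z ^ p ∧ ν ≠ 0 ∧
      (1 + (1 - ‖z‖)) * ‖ν‖ ≤ ‖μ‖ ∧ ‖μ‖ ≤ ‖(SzegoT α p z).trace‖ + 1 := by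
  set t := (SzegoT α p z).trace with ht
  have hex : ∃ μ ν : ℂ, μ + ν = t ∧ μ * ν = z ^ p ∧ ‖ν‖ ≤ ‖μ‖ := by
    obtain ⟨s, hs⟩ := IsAlgClosed.exists_eq_mul_self (t ^ 2 - 4 * z ^ p)
    rcases le_total ‖(t - s) / 2‖ ‖(t + s) / 2‖ with hle | hle
    · exact ⟨(t + s) / 2, (t - s) / 2, by ring, by linear_combination hs / 4, hle⟩
    · exact ⟨(t - s) / 2, (t + s) / 2, by ring, by linear_combination hs / 4, hle⟩
  obtain ⟨μ, ν, hsum, hprod, hle⟩ := hex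
  have hzp : z ^ p ≠ 0 := pow_ne_zero _ hz0
  have hν : ν ≠ 0 := by rintro rfl; rw [mul_zero] at hprod; exact hzp hprod.symm
  have hν0 : 0 < ‖ν‖ := norm_pos_iff.2 hν
  have hμ0 : 0 < ‖μ‖ := hν0.trans_le hle
  have hnorm : ‖μ‖ * ‖ν‖ = ‖z‖ ^ p := by rw [← norm_mul, hprod, norm_pow]
  have hgap := eigenvalue_norm_gap h hp hz (μ := μ) (by rw [← ht, ← hsum, ← hprod]; ring)
  rw [← hnorm, abs_of_nonneg (by nlinarith)] at hgap
  refine ⟨μ, ν, hsum, hprod, hν, ?_, ?_⟩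
  · refine le_of_mul_le_mul_left ?_ hμ0
    nlinarith
  · have h1 : μ = t - ν := by rw [← hsum]; ring
    have hν1 : ‖ν‖ ≤ 1 := by
      have : ‖z‖ ^ p ≤ 1 := pow_le_one₀ (norm_nonneg _) hz
      nlinarith
    rw [h1]
    exact (norm_sub_le _ _).trans (by linarith)

namespace IsSzegoPair

variable {α : ℕ → ℂ} {φ φs : ℕ → Polynomial ℂ} {p : ℕ}

lemma eval_mul_add_recurrence (h : IsSzegoPair α φ φs) (hper : ∀ n, α (n + p) = α n) (b : ℕ)
    {z μ ν : ℂ} (hsum : μ + ν = (SzegoT α p z).trace) (hprod : μ * ν = z ^ p) (m : ℕ) :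
    (φ ((m + 2) * p + b)).eval z = (μ + ν) * (φ ((m + 1) * p + b)).eval z -
      μ * ν * (φ (m * p + b)).eval z := by
  have e1 : (m + 2) * p + b = m * p + b + p + p := by ring
  have e2 : (m + 1) * p + b = m * p + b + p := by ring
  rw [hsum, hprod, e1, e2]
  exact (h.eval_recurrence hper _ z).1

lemma pow_mul_eq_of_eval_eq_zero (h : IsSzegoPair α φ φs) (hper : ∀ n, α (n + p) = α n)
    {b m : ℕ} {z μ ν : ℂ} (hsum : μ + ν = (SzegoT α p z).trace) (hprod : μ * ν = z ^ p)
    (hz : (φ (m * p + b)).eval z = 0) :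
    μ ^ m * ((φ (p + b)).eval z - ν * (φ b).eval z) =
      ν ^ m * ((φ (p + b)).eval z - μ * (φ b).eval z) := by
  have h1 := sub_mul_eq_pow_mul_of_recurrence (y := fun m => (φ (m * p + b)).eval z)
    (h.eval_mul_add_recurrence hper b hsum hprod) m
  have h2 := sub_mul_eq_pow_mul_of_recurrence (y := fun m => (φ (m * p + b)).eval z)
    (h.eval_mul_add_recurrence hper b ((add_comm ν μ).trans hsum)
      ((mul_comm ν μ).trans hprod)) m
  simp only [hz, mul_zero, sub_zero, one_mul, zero_mul, zero_add] at h1 h2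
  rw [← h1, ← h2]

/-- The polynomial `φ_{p+b}² - tr(T_p) φ_{p+b} φ_b + z^p φ_b²` does not vanish identically. -/
lemma quadratic_ne_zero (h : IsSzegoPair α φ φs) (hp : 0 < p) (hper : ∀ n, α (n + p) = α n)
    {K : ℝ} (hK : ∀ n, ((φ n).roots.map fun a => 1 - ‖a‖).sum ≤ K) (b : ℕ) {t : Polynomial ℂ}
    (ht : ∀ z, t.eval z = (SzegoT α p z).trace) :
    φ (p + b) ^ 2 - t * φ (p + b) * φ b + X ^ p * φ b ^ 2 ≠ 0 := by
  intro hQ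
  obtain ⟨c, hc, hc1, hroots⟩ := exists_pos_le_one_sub_norm (φ b).roots
  obtain ⟨m, hm⟩ := exists_nat_gt (K / c)
  have key : ∀ a ∈ (φ (m * p + b)).roots, c ≤ 1 - ‖a‖ := by
    intro z hz
    have hz1 := h.norm_lt_one_of_mem_roots hz
    by_cases hz0 : z = 0
    · rw [hz0, norm_zero, sub_zero]; exact hc1
    refine hroots z ((mem_roots (h.ne_zero b)).2 ?_) hz1
    obtain ⟨μ, ν, hsum, hprod, hν, hgap, -⟩ := exists_eigenvalues h.norm_lt hp hz0 hz1.le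
    have hν0 : 0 < ‖ν‖ := norm_pos_iff.2 hν
    have hlt : ‖ν‖ < ‖μ‖ := by nlinarith
    have hμ : μ ≠ 0 := norm_pos_iff.1 (hν0.trans hlt)
    have h1 := h.pow_mul_eq_of_eval_eq_zero hper hsum hprod ((mem_roots (h.ne_zero _)).1 hz)
    have h2 : ((φ (p + b)).eval z - ν * (φ b).eval z) *
        ((φ (p + b)).eval z - μ * (φ b).eval z) = 0 := by
      have := congrArg (eval z) hQ
      simp only [eval_add, eval_sub, eval_mul, eval_pow, eval_X, eval_zero, ht, ← hsum,
        ← hprod] at this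
      linear_combination this
    have h3 : (φ (p + b)).eval z = ν * (φ b).eval z ∧ (φ (p + b)).eval z = μ * (φ b).eval z := by
      rcases mul_eq_zero.1 h2 with h0 | h0
      · rw [h0, mul_zero, eq_comm] at h1
        exact ⟨sub_eq_zero.1 h0,
          sub_eq_zero.1 ((mul_eq_zero.1 h1).resolve_left (pow_ne_zero _ hν))⟩
      · rw [h0, mul_zero] at h1
        exact ⟨sub_eq_zero.1 ((mul_eq_zero.1 h1).resolve_left (pow_ne_zero _ hμ)),
          sub_eq_zero.1 h0⟩
    have h4 : (μ - ν) * (φ b).eval z = 0 := by linear_combination h3.1 - h3.2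
    refine (mul_eq_zero.1 h4).resolve_left fun h0 => ?_
    rw [sub_eq_zero.1 h0] at hlt
    exact lt_irrefl _ hlt
  have h1 := Multiset.card_nsmul_le_sum (s := (φ (m * p + b)).roots.map fun a => 1 - ‖a‖)
    (a := c) (fun x hx => by obtain ⟨a, ha, rfl⟩ := Multiset.mem_map.1 hx; exact key a ha)
  rw [Multiset.card_map, h.card_roots, nsmul_eq_mul] at h1
  have h2 := h1.trans (hK _)
  rw [div_lt_iff₀ hc] at hm
  have h3 : (m : ℝ) ≤ ((m * p + b : ℕ) : ℝ) := by
    have : m ≤ m * p + b := by nlinarith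
    exact_mod_cast this
  nlinarith

lemma exists_pow_mul_pow_le (h : IsSzegoPair α φ φs) (hp : 0 < p) (hper : ∀ n, α (n + p) = α n)
    {K : ℝ} (hK : ∀ n, ((φ n).roots.map fun a => 1 - ‖a‖).sum ≤ K) (b : ℕ) :
    ∃ c : ℝ, 0 < c ∧ ∃ A : ℝ, 1 ≤ A ∧ ∃ d : ℕ, ∀ m : ℕ, ∀ z : ℂ, z ≠ 0 →
      (φ (m * p + b)).eval z = 0 → 1 - ‖z‖ ≤ c →
      (1 + (1 - ‖z‖)) ^ m * (1 - ‖z‖) ^ d ≤ A := by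
  obtain ⟨t, ht⟩ := trace_szegoT_polynomial α p
  set Q := φ (p + b) ^ 2 - t * φ (p + b) * φ b + X ^ p * φ b ^ 2 with hQ
  have hQ0 : Q ≠ 0 := h.quadratic_ne_zero hp hper hK b ht
  obtain ⟨c, hc, hlow⟩ := exists_pow_le_norm_eval Q
  obtain ⟨L1, hL1, hb1⟩ := exists_norm_eval_le (φ (p + b))
  obtain ⟨L0, hL0, hb0⟩ := exists_norm_eval_le (φ b)
  obtain ⟨Lt, hLt, hbt⟩ := exists_norm_eval_le t
  have hlead : 0 < ‖Q.leadingCoeff‖ := norm_pos_iff.2 (leadingCoeff_ne_zero.2 hQ0)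
  set E := (L1 + (Lt + 1) * L0) ^ 2 / ‖Q.leadingCoeff‖ with hE
  refine ⟨c, hc, max 1 E, le_max_left _ _, Q.natDegree, fun m z hz0 hz hzc => ?_⟩
  refine le_trans ?_ (le_max_right _ _)
  have hz1 := (h.norm_lt_one_of_eval_eq_zero hz).le
  obtain ⟨μ, ν, hsum, hprod, hν, hgap, hμt⟩ := exists_eigenvalues h.norm_lt hp hz0 hz1
  have hν0 : 0 < ‖ν‖ := norm_pos_iff.2 hν
  have h1 := h.pow_mul_eq_of_eval_eq_zero hper hsum hprod hz
  have hQz : Q.eval z = ((φ (p + b)).eval z - ν * (φ b).eval z) *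
      ((φ (p + b)).eval z - μ * (φ b).eval z) := by
    rw [hQ]
    simp only [eval_add, eval_sub, eval_mul, eval_pow, eval_X, ht, ← hsum, ← hprod]
    ring
  have h2 : μ ^ m * Q.eval z = ν ^ m * ((φ (p + b)).eval z - μ * (φ b).eval z) ^ 2 := by
    rw [hQz]; linear_combination ((φ (p + b)).eval z - μ * (φ b).eval z) * h1
  have h3 := congrArg norm h2
  rw [norm_mul, norm_mul, norm_pow, norm_pow, norm_pow] at h3
  have h4 : ‖(φ (p + b)).eval z - μ * (φ b).eval z‖ ≤ L1 + (Lt + 1) * L0 := by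
    refine (norm_sub_le _ _).trans (add_le_add (hb1 z hz1) ?_)
    rw [norm_mul]
    refine mul_le_mul (hμt.trans ?_) (hb0 z hz1) (norm_nonneg _) (by linarith)
    have := hbt z hz1
    rw [ht] at this
    linarith
  have h5 : (1 + (1 - ‖z‖)) ^ m * ‖Q.eval z‖ ≤ (L1 + (Lt + 1) * L0) ^ 2 := by
    refine le_of_mul_le_mul_left ?_ (pow_pos hν0 m)
    calc ‖ν‖ ^ m * ((1 + (1 - ‖z‖)) ^ m * ‖Q.eval z‖)
        = ((1 + (1 - ‖z‖)) * ‖ν‖) ^ m * ‖Q.eval z‖ := by rw [mul_pow]; ring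
      _ ≤ ‖μ‖ ^ m * ‖Q.eval z‖ := by
        refine mul_le_mul_of_nonneg_right (pow_le_pow_left₀ ?_ hgap m) (norm_nonneg _)
        exact mul_nonneg (by linarith) hν0.le
      _ = _ := h3
      _ ≤ _ := by
        refine mul_le_mul_of_nonneg_left ?_ (pow_nonneg hν0.le m)
        exact pow_le_pow_left₀ (norm_nonneg _) h4 2
  rw [hE, le_div_iff₀ hlead]
  calc (1 + (1 - ‖z‖)) ^ m * (1 - ‖z‖) ^ Q.natDegree * ‖Q.leadingCoeff‖
      = (1 + (1 - ‖z‖)) ^ m * (‖Q.leadingCoeff‖ * (1 - ‖z‖) ^ Q.natDegree) := by ring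
    _ ≤ (1 + (1 - ‖z‖)) ^ m * ‖Q.eval z‖ :=
      mul_le_mul_of_nonneg_left (hlow z hz1 hzc) (pow_nonneg (by linarith) m)
    _ ≤ _ := h5

end IsSzegoPair

lemma le_mul_log_div_of_pow_mul_pow_le {δ A : ℝ} {n m p b d : ℕ} (hδ0 : 0 < δ) (hδ1 : δ ≤ 1)
    (hA : 1 ≤ A) (hn : 3 ≤ n) (hnm : n = m * p + b) (hb : b < p)
    (h : (1 + δ) ^ m * δ ^ d ≤ A) :
    δ ≤ (p * (2 * (Real.log A + d) + 1)) * Real.log n / n := by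
  have hn' : (3 : ℝ) ≤ n := by exact_mod_cast hn
  have hn0 : (0 : ℝ) < n := by linarith
  have hlogn : 1 ≤ Real.log n := by
    rw [Real.le_log_iff_exp_le hn0]
    linarith [Real.exp_one_lt_d9]
  have hlogA := Real.log_nonneg hA
  have hp1 : (1 : ℝ) ≤ p := by exact_mod_cast (by omega : 1 ≤ p)
  have hd : (0 : ℝ) ≤ d := Nat.cast_nonneg d
  rw [le_div_iff₀ hn0]
  rcases le_or_gt (δ * n) 1 with hsmall | hlarge
  · refine hsmall.trans (one_le_mul_of_one_le_of_one_le ?_ hlogn)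
    exact one_le_mul_of_one_le_of_one_le hp1 (by linarith)
  · have h1 := Real.log_le_log (by positivity) h
    rw [Real.log_mul (by positivity) (by positivity), Real.log_pow, Real.log_pow] at h1
    have h2 : -Real.log n ≤ Real.log δ := by
      rw [← Real.log_inv]
      refine Real.log_le_log (by positivity) ?_
      rw [inv_le_iff_one_le_mul₀ hn0]
      exact hlarge.le
    have h3 : δ / 2 ≤ Real.log (1 + δ) := by
      refine le_trans ?_ (Real.le_log_one_add_of_nonneg hδ0.le)
      rw [div_le_div_iff₀ two_pos (by linarith)]
      nlinarith
    have h4 : (m : ℝ) * (δ / 2) ≤ (Real.log A + d) * Real.log n := by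
      have h5 := mul_le_mul_of_nonneg_left h3 (Nat.cast_nonneg m)
      have h6 := mul_le_mul_of_nonneg_left h2 hd
      have h7 : Real.log A ≤ Real.log A * Real.log n := le_mul_of_one_le_right hlogA hlogn
      nlinarith
    have h8 : (n : ℝ) ≤ p * (m + 1) := by
      have : n ≤ p * (m + 1) := by rw [hnm]; nlinarith
      exact_mod_cast this
    calc δ * n ≤ δ * (p * (m + 1)) := mul_le_mul_of_nonneg_left h8 hδ0.le
      _ = p * (2 * (m * (δ / 2)) + δ) := by ring
      _ ≤ p * (2 * ((Real.log A + d) * Real.log n) + Real.log n) := by gcongr; linarith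
      _ = _ := by ring

/-- Zeros sufficiently close to the circle are within `O(log n / n)` of it. -/
lemma IsSzegoPair.exists_log_bound {α : ℕ → ℂ} {φ φs : ℕ → Polynomial ℂ} {p : ℕ}
    (h : IsSzegoPair α φ φs) (hp : 0 < p) (hper : ∀ n, α (n + p) = α n)
    {K : ℝ} (hK : ∀ n, ((φ n).roots.map fun a => 1 - ‖a‖).sum ≤ K) :
    ∃ k : ℝ, 0 < k ∧ ∀ n : ℕ, 3 ≤ n → ∀ z : ℂ, z ≠ 0 → (φ n).eval z = 0 →
      (1 - ‖z‖) * k ≤ 1 → 1 - ‖z‖ ≤ k * Real.log n / n := by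
  have hb : ∀ b : ℕ, ∃ k : ℝ, 0 < k ∧ (b < p → ∀ m : ℕ, 3 ≤ m * p + b → ∀ z : ℂ, z ≠ 0 →
      (φ (m * p + b)).eval z = 0 → (1 - ‖z‖) * k ≤ 1 →
      1 - ‖z‖ ≤ k * Real.log (m * p + b : ℕ) / (m * p + b : ℕ)) := by
    intro b
    obtain ⟨c, hc, A, hA, d, hbound⟩ := h.exists_pow_mul_pow_le hp hper hK b
    have hlogA := Real.log_nonneg hA
    set k₀ : ℝ := p * (2 * (Real.log A + d) + 1) with hk₀
    have hk₀0 : 0 ≤ k₀ := by positivity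
    have hcinv : 0 < c⁻¹ := inv_pos.2 hc
    refine ⟨k₀ + c⁻¹, by positivity, fun hbp m hm z hz0 hz hzk => ?_⟩
    have hδ : 0 < 1 - ‖z‖ := sub_pos.2 (h.norm_lt_one_of_eval_eq_zero hz)
    have hδc : 1 - ‖z‖ ≤ c := by
      have : (1 - ‖z‖) * c⁻¹ ≤ 1 := by nlinarith
      rwa [← div_eq_mul_inv, div_le_one hc] at this
    refine (le_mul_log_div_of_pow_mul_pow_le hδ (by linarith [norm_nonneg z]) hA hm rfl hbp
      (hbound m z hz0 hz hδc)).trans ?_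
    gcongr
    exact le_add_of_nonneg_right hcinv.le
  choose k hk0 hk using hb
  have hle : ∀ b < p, k b ≤ ∑ b ∈ Finset.range p, k b := fun b hbp =>
    Finset.single_le_sum (fun i _ => (hk0 i).le) (Finset.mem_range.2 hbp)
  refine ⟨∑ b ∈ Finset.range p, k b, (hk0 0).trans_le (hle 0 hp), fun n hn z hz0 hz hzk => ?_⟩
  have hmod : n / p * p + n % p = n := by rw [mul_comm]; exact Nat.div_add_mod n p
  have hlt := Nat.mod_lt n hp
  have hδ : 0 < 1 - ‖z‖ := sub_pos.2 (h.norm_lt_one_of_eval_eq_zero hz)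
  have h1 := hk (n % p) hlt (n / p)
  rw [hmod] at h1
  refine (h1 hn z hz0 hz ((mul_le_mul_of_nonneg_left (hle _ hlt) hδ.le).trans hzk)).trans ?_
  gcongr
  exact hle _ hlt

lemma exists_forall_rpow_mul_le (k : ℝ) : ∃ N₁ : ℕ, 3 ≤ N₁ ∧ ∀ n : ℕ, N₁ ≤ n →
    (n : ℝ) ^ (-(1 / 2 : ℝ)) * k ≤ 1 ∧ k * Real.log n / n ≤ (n : ℝ) ^ (-(1 / 2 : ℝ)) := by
  have h1 : Filter.Tendsto (fun n : ℕ => (n : ℝ) ^ (-(1 / 2 : ℝ)) * k) Filter.atTop (nhds 0) := by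
    simpa using ((tendsto_rpow_neg_atTop (y := 1 / 2) (by norm_num)).comp
      tendsto_natCast_atTop_atTop).mul_const k
  have h2 : Filter.Tendsto (fun n : ℕ => Real.log n / (n : ℝ) ^ (1 / 2 : ℝ) * k) Filter.atTop
      (nhds 0) := by
    simpa using ((isLittleO_log_rpow_atTop (r := 1 / 2) (by norm_num)).tendsto_div_nhds_zero.comp
      tendsto_natCast_atTop_atTop).mul_const k
  obtain ⟨N₁, hN₁⟩ := Filter.eventually_atTop.1
    ((h1.eventually_le_const one_pos).and (h2.eventually_le_const one_pos))
  refine ⟨max N₁ 3, le_max_right _ _, fun n hn => ?_⟩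
  obtain ⟨h3, h4⟩ := hN₁ n ((le_max_left _ _).trans hn)
  refine ⟨h3, ?_⟩
  have hn0 : (0 : ℝ) < n := by
    have := (le_max_right N₁ 3).trans hn
    exact_mod_cast (by omega : 0 < n)
  have hs : (0 : ℝ) < (n : ℝ) ^ (1 / 2 : ℝ) := Real.rpow_pos_of_pos hn0 _
  have hss : (n : ℝ) ^ (1 / 2 : ℝ) * (n : ℝ) ^ (1 / 2 : ℝ) = n := by
    rw [← Real.rpow_add hn0]; norm_num
  rw [Real.rpow_neg hn0.le]
  calc k * Real.log n / n
      = (Real.log n / (n : ℝ) ^ (1 / 2 : ℝ) * k) * ((n : ℝ) ^ (1 / 2 : ℝ))⁻¹ := by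
        nth_rw 2 [← hss]; field_simp
    _ ≤ 1 * ((n : ℝ) ^ (1 / 2 : ℝ))⁻¹ := by gcongr
    _ = _ := one_mul _

lemma sum_card_filter_le {ι β : Type*} (S : Finset ι) (Q : ι → β → Prop)
    [∀ i, DecidablePred (Q i)] (R : Multiset β)
    (hQ : ∀ a ∈ R, ∀ i ∈ S, ∀ j ∈ S, Q i a → Q j a → i = j) :
    ∑ i ∈ S, Multiset.card (R.filter (Q i)) ≤ Multiset.card R := by
  induction R using Multiset.induction with
  | empty => simp
  | cons a R ih =>
    have h1 : ∑ i ∈ S, (if Q i a then 1 else 0) ≤ 1 := by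
      rw [Finset.sum_boole, Nat.cast_id, Finset.card_le_one]
      intro i hi j hj
      rw [Finset.mem_filter] at hi hj
      exact hQ a (Multiset.mem_cons_self a R) i hi.1 j hj.1 hi.2 hj.2
    calc ∑ i ∈ S, Multiset.card ((a ::ₘ R).filter (Q i))
        = ∑ i ∈ S, ((if Q i a then 1 else 0) + Multiset.card (R.filter (Q i))) := by
          refine Finset.sum_congr rfl fun i _ => ?_
          by_cases hi : Q i a <;> simp [hi, add_comm]
      _ ≤ 1 + Multiset.card R := by
          rw [Finset.sum_add_distrib]
          exact add_le_add h1 (ih fun b hb => hQ b (Multiset.mem_cons_of_mem hb))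
      _ = _ := by rw [Multiset.card_cons, add_comm]

lemma card_filter_le_add_mul_sum {β : Type*} {R : Multiset β} {f : β → ℝ} (hf : ∀ a ∈ R, 0 ≤ f a)
    {k : ℝ} (hk : 0 ≤ k) {P Q : β → Prop} [DecidablePred P] [DecidablePred Q]
    (h : ∀ a ∈ R, P a → ¬ Q a → 1 ≤ f a * k) :
    (Multiset.card (R.filter P) : ℝ) ≤ Multiset.card (R.filter Q) + k * (R.map f).sum := by
  induction R using Multiset.induction with
  | empty => simp
  | cons a R ih =>
    have ih := ih (fun b hb => hf b (Multiset.mem_cons_of_mem hb))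
      fun b hb => h b (Multiset.mem_cons_of_mem hb)
    have h1 := h a (Multiset.mem_cons_self a R)
    have h2 := mul_nonneg (hf a (Multiset.mem_cons_self a R)) hk
    rw [Multiset.map_cons, Multiset.sum_cons]
    by_cases hP : P a <;> by_cases hQ : Q a
    · simp only [Multiset.filter_cons_of_pos _ hP, Multiset.filter_cons_of_pos _ hQ,
        Multiset.card_cons]
      push_cast; linarith
    · have := h1 hP hQ
      simp only [Multiset.filter_cons_of_pos _ hP, Multiset.filter_cons_of_neg _ hQ,
        Multiset.card_cons]
      push_cast; linarith
    · simp only [Multiset.filter_cons_of_neg _ hP, Multiset.filter_cons_of_pos _ hQ,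
        Multiset.card_cons]
      push_cast; linarith
    · simp only [Multiset.filter_cons_of_neg _ hP, Multiset.filter_cons_of_neg _ hQ]
      linarith

lemma abs_sub_le_of_sum_le {ι : Type*} {S : Finset ι} {p : ℕ} (hp : 0 < p) (hS : S.card = p)
    {f : ι → ℝ} {n K : ℝ} (hK : 0 ≤ K) (hlow : ∀ i ∈ S, n / p - K ≤ f i)
    (hsum : ∑ i ∈ S, f i ≤ n) {i : ι} (hi : i ∈ S) : |f i - n / p| ≤ p * K := by
  have hp1 : (1 : ℝ) ≤ p := by exact_mod_cast hp
  have h1 : f i - (n / p - K) ≤ ∑ j ∈ S, (f j - (n / p - K)) :=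
    Finset.single_le_sum (f := fun j => f j - (n / p - K)) (fun j hj => sub_nonneg.2 (hlow j hj)) hi
  rw [Finset.sum_sub_distrib, Finset.sum_const, hS, nsmul_eq_mul, mul_sub,
    mul_div_cancel₀ _ (by positivity)] at h1
  have h2 := hlow i hi
  rw [abs_le]
  constructor <;> nlinarith

open scoped Classical in
/-- **Theorem 3.5.** Assume all gaps are open (the band set has exactly `p` connected
components).  Let `N^{(n,B')}` be the number of zeros `z₀` of `φ_n` (with multiplicity)
with `z₀ ≠ 0`, `z₀/|z₀| ∈ B'` and `1 - |z₀| ≤ n^{-1/2}`.  Then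
(a) `sup_{n,B'} |N^{(n,B')} - n/p| < ∞`, and (b) for large `n` all such zeros satisfy
`1 - |z₀| ≤ C log n / n`. -/
theorem opuc_periodic_band_zero_count_and_location
    (p : ℕ) (hp : 0 < p) (hpeven : Even p)
    (α : ℕ → ℂ)
    (hα : ∀ n, ‖α n‖ < 1)
    (hper : ∀ n, α (n + p) = α n)
    (φ φs : ℕ → Polynomial ℂ)
    (hφ0 : φ 0 = 1)
    (hφrec : ∀ n, φ (n + 1) =
      C ((szRho α n : ℂ))⁻¹ * (X * φ n - C (starRingEnd ℂ (α n)) * φs n))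
    (hφs : ∀ n, ∀ z : ℂ, z ≠ 0 →
      aeval z (φs n) = z ^ n * starRingEnd ℂ (aeval ((starRingEnd ℂ z)⁻¹) (φ n)))
    (hgaps : {B : Set ℂ | szIsBand α p B}.ncard = p)
    (N : ℕ → Set ℂ → ℕ)
    (hN : ∀ n B', N n B' = Multiset.card (Multiset.filter
      (fun z₀ : ℂ => z₀ ≠ 0 ∧ z₀ / (‖z₀‖ : ℂ) ∈ B' ∧
        1 - ‖z₀‖ ≤ ((n : ℝ)) ^ (-(1 / 2 : ℝ))) ((φ n).roots))) :
    (∃ Cbd : ℝ, ∀ n : ℕ, 1 ≤ n → ∀ B' : Set ℂ, szIsBand α p B' →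
        |(N n B' : ℝ) - (n : ℝ) / (p : ℝ)| ≤ Cbd) ∧
      (∃ Cloc > (0 : ℝ), ∃ N₀ : ℕ, ∀ n : ℕ, N₀ ≤ n → ∀ z₀ : ℂ,
        aeval z₀ (φ n) = 0 → z₀ ≠ 0 →
        (∃ B' : Set ℂ, szIsBand α p B' ∧ z₀ / (‖z₀‖ : ℂ) ∈ B') →
        1 - ‖z₀‖ ≤ ((n : ℝ)) ^ (-(1 / 2 : ℝ)) →
        1 - ‖z₀‖ ≤ Cloc * Real.log n / n) := by
  have h := isSzegoPair_of_rev hα hφ0 hφrec hφs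
  obtain ⟨K, hK0, hK⟩ := h.exists_sector_bound hp hpeven hper hgaps
  obtain ⟨k, hk0, hk⟩ := h.exists_log_bound hp hper fun n => (hK n).1
  obtain ⟨N₁, hN₁3, hN₁⟩ := exists_forall_rpow_mul_le k
  have hfin : {B : Set ℂ | szIsBand α p B}.Finite :=
    Set.finite_of_ncard_ne_zero (by rw [hgaps]; exact hp.ne')
  have hp1 : (1 : ℝ) ≤ p := by exact_mod_cast hp
  refine ⟨⟨p * (K + k * K) + N₁, fun n _ B hB => ?_⟩, k, hk0, N₁, fun n hn z hz hz0 _ hle => ?_⟩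
  · have hKK : 0 ≤ K + k * K := by positivity
    rcases lt_or_ge n N₁ with hn | hn
    · have h1 : (N n B : ℝ) ≤ n := by
        rw [hN]
        exact_mod_cast (Multiset.card_le_card (Multiset.filter_le _ _)).trans (h.card_roots n).le
      have h2 : (n : ℝ) / p ≤ n := div_le_self n.cast_nonneg hp1
      have h3 : (0 : ℝ) ≤ (n : ℝ) / p := by positivity
      have h4 : (n : ℝ) ≤ N₁ := by exact_mod_cast hn.le
      have h5 : (0 : ℝ) ≤ N n B := (N n B).cast_nonneg
      have h6 : 0 ≤ p * (K + k * K) := by positivity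
      rw [abs_le]
      constructor <;> linarith
    · refine (abs_sub_le_of_sum_le hp (by rw [← Set.ncard_eq_toFinset_card _ hfin, hgaps])
        (f := fun B => (N n B : ℝ)) hKK (fun B hB => ?_) ?_ (hfin.mem_toFinset.2 hB)).trans
        (le_add_of_nonneg_right N₁.cast_nonneg)
      · have h1 := (hK n).2 B (hfin.mem_toFinset.1 hB)
        have h2 := card_filter_le_add_mul_sum (R := (φ n).roots) (f := fun a => 1 - ‖a‖)
          (P := fun a => a ≠ 0 ∧ a / (‖a‖ : ℂ) ∈ B)
          (Q := fun a => a ≠ 0 ∧ a / (‖a‖ : ℂ) ∈ B ∧ 1 - ‖a‖ ≤ (n : ℝ) ^ (-(1 / 2 : ℝ)))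
          (fun a ha => sub_nonneg.2 (h.norm_lt_one_of_mem_roots ha).le) hk0.le
          fun a ha hP hQ => by
            by_contra! hlt
            exact hQ ⟨hP.1, hP.2, (hk n (hN₁3.trans hn) a hP.1 (Polynomial.isRoot_of_mem_roots ha)
              hlt.le).trans (hN₁ n hn).2⟩
        rw [← hN n B] at h2
        have h3 := mul_le_mul_of_nonneg_left (hK n).1 hk0.le
        linarith
      · rw [← Nat.cast_sum, Nat.cast_le]
        simp only [hN]
        refine (sum_card_filter_le _ _ _ ?_).trans (h.card_roots n).le
        intro a _ B hB B' hB' hQ hQ'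
        exact szIsBand_eq_of_mem (hfin.mem_toFinset.1 hB) (hfin.mem_toFinset.1 hB') hQ.2.1 hQ'.2.1
  · rw [Polynomial.coe_aeval_eq_eval] at hz
    exact hk n (hN₁3.trans hn) z hz0 hz
      ((mul_le_mul_of_nonneg_right hle hk0.le).trans (hN₁ n hn).1)
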